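/- arXiv:0812.0540 — 2 statements merged into one kernel-verified Lean document; each statement's English description precedes it below -/
import Mathlib

section
/- Fix positive integers a, b, c with gcd(a,b,c) = 1. The form f(x,y,z) = a·x² + b·y² + c·t_z (x, y ∈ ℤ, z ∈ ℕ) is asymptotically universal if and only if both of the following hold: (1) −2bc R a′, −2ac R b′, and −ab R c′; (2) either 4 ∤ c, or both 4 ∥ c and 2 ∥ ab (where 2^k ∥ m means 2^k divides m but 2^{k+1} does not). -/
/-- The `k`-th triangular number. -/
def triangular (k : ℕ) : ℕ := k * (k + 1) / 2

/-- The odd part `m'` of `m`, i.e. `m = 2^(v₂ m) * m'` with `m'` odd. -/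
def oddPart (m : ℕ) : ℕ := m / 2 ^ (m.factorization 2)

/-- `d R m` : the Legendre symbol `(d/p)` equals `1` for every prime `p ∣ m`. -/
def isQR (d : ℤ) (m : ℕ) : Prop :=
  ∀ p : ℕ, (hp : p.Prime) → p ∣ m → @legendreSym p ⟨hp⟩ d = 1

/-- A solvability predicate is asymptotically universal if its exceptional set
has asymptotic density zero. -/
def AsympUniversal (sol : ℕ → Prop) : Prop :=
  Filter.Tendsto (fun N : ℕ => ({n : ℕ | n < N ∧ ¬ sol n}.ncard : ℝ) / N)
    Filter.atTop (nhds 0)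

section Density

open Finset

theorem card_linear_zmod (n : ℕ) [NeZero n] (a b : ZMod n) :
    #{p : ZMod n × ZMod n | a * p.1 + b * p.2 = 0} ≤ n * n.gcd (a.val.gcd b.val) := by
  set d := n.gcd (a.val.gcd b.val) with hd
  have hn : 0 < n := Nat.pos_of_ne_zero (NeZero.ne n)
  have hdpos : 0 < d := Nat.gcd_pos_of_pos_left _ hn
  have hdn : d ∣ n := Nat.gcd_dvd_left _ _
  let f : ZMod n × ZMod n →+ ZMod n :=
    (AddMonoidHom.mulLeft a).coprod (AddMonoidHom.mulLeft b)
  have hf : ∀ p, f p = a * p.1 + b * p.2 := fun p => rfl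
  have hker : #{p : ZMod n × ZMod n | a * p.1 + b * p.2 = 0} = Nat.card f.ker := by
    exact (Nat.subtype_card _ (by simp [AddMonoidHom.mem_ker, hf])).symm
  have hmul : Nat.card f.range * Nat.card f.ker = n * n := by
    have h1 := AddSubgroup.card_mul_index f.ker
    rw [AddSubgroup.index_ker] at h1
    rw [mul_comm, h1, Nat.card_prod, Nat.card_zmod]
  have hmem : (d : ZMod n) ∈ f.range := by
    have h1 : ((d : ℤ) : ZMod n) = ((n * n.gcdA (a.val.gcd b.val)
        + (a.val.gcd b.val : ℕ) * n.gcdB (a.val.gcd b.val) : ℤ) : ZMod n) := by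
      rw [hd, Nat.gcd_eq_gcd_ab]
    have h2 : (((a.val.gcd b.val : ℕ) : ℤ) : ZMod n) =
        ((a.val * a.val.gcdA b.val + b.val * a.val.gcdB b.val : ℤ) : ZMod n) := by
      rw [Nat.gcd_eq_gcd_ab]
    push_cast at h1 h2
    rw [h2] at h1
    simp only [ZMod.natCast_self, zero_mul, zero_add, ZMod.natCast_val, ZMod.cast_id', id] at h1
    refine ⟨(a.val.gcdA b.val * n.gcdB (a.val.gcd b.val),
      a.val.gcdB b.val * n.gcdB (a.val.gcd b.val)), ?_⟩
    rw [h1, hf]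
    ring
  have hle : n / d ≤ Nat.card f.range := by
    have h1 : AddSubgroup.zmultiples (d : ZMod n) ≤ f.range := by
      rwa [AddSubgroup.zmultiples_le]
    have h2 := AddSubgroup.card_le_of_le h1
    rwa [Nat.card_zmultiples, ZMod.addOrderOf_coe _ hn.ne', Nat.gcd_eq_right hdn] at h2
  rw [hker]
  have h3 : n / d * Nat.card f.ker ≤ n * n := hmul ▸ Nat.mul_le_mul_right _ hle
  have h4 : n * Nat.card f.ker ≤ n * (n * d) := by
    calc n * Nat.card f.ker = d * (n / d * Nat.card f.ker) := by
          rw [← mul_assoc, Nat.mul_div_cancel' hdn]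
      _ ≤ d * (n * n) := Nat.mul_le_mul_left _ h3
      _ = n * (n * d) := by ring
  exact Nat.le_of_mul_le_mul_left h4 hn

theorem card_filter_dvd_pair_le {n d : ℕ} [NeZero n] (hd : d ∣ n) :
    #{p : ZMod n × ZMod n | d ∣ p.1.val ∧ d ∣ p.2.val} ≤ (n / d) ^ 2 := by
  have hn : 0 < n := Nat.pos_of_ne_zero (NeZero.ne n)
  have hdp : 0 < d := Nat.pos_of_dvd_of_pos hd hn
  calc _ ≤ #(range (n / d) ×ˢ range (n / d)) := by
        refine card_le_card_of_injOn (fun p => (p.1.val / d, p.2.val / d)) ?_ ?_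
        · rintro ⟨x, y⟩ h
          simp only [coe_product, coe_range, Set.mem_prod, Set.mem_Iio]
          exact ⟨Nat.div_lt_div_of_lt_of_dvd hd (ZMod.val_lt x),
            Nat.div_lt_div_of_lt_of_dvd hd (ZMod.val_lt y)⟩
        · rintro ⟨x, y⟩ h ⟨x', y'⟩ h' heq
          simp only [coe_filter, mem_univ, true_and, Set.mem_ofPred_eq, Prod.mk.injEq] at h h' heq
          obtain ⟨⟨u, hu⟩, ⟨v, hv⟩⟩ := h
          obtain ⟨⟨u', hu'⟩, ⟨v', hv'⟩⟩ := h'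
          rw [hu, hv, hu', hv'] at heq
          simp only [Nat.mul_div_cancel_left _ hdp] at heq
          rw [Prod.mk.injEq]
          exact ⟨ZMod.val_injective n (by rw [hu, hu', heq.1]),
            ZMod.val_injective n (by rw [hv, hv', heq.2])⟩
    _ = (n / d) ^ 2 := by rw [card_product, card_range, sq]

/-- The hyperbolic form `s₁ u + v₁ t` has at most `n² σ(n)` zeros modulo `n`. -/
theorem card_hyperbolic_zeros_le (n : ℕ) [NeZero n] :
    #{q : (ZMod n × ZMod n) × (ZMod n × ZMod n) | q.1.1 * q.2.1 + q.1.2 * q.2.2 = 0} ≤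
      n ^ 2 * ∑ d ∈ n.divisors, d := by
  have hn : n ≠ 0 := NeZero.ne n
  calc _ = ∑ p : ZMod n × ZMod n, #{r : ZMod n × ZMod n | p.1 * r.1 + p.2 * r.2 = 0} := by
        rw [card_filter, ← univ_product_univ, sum_product]
        exact sum_congr rfl fun p _ => (card_filter _ _).symm
    _ ≤ ∑ p : ZMod n × ZMod n, ∑ d ∈ n.divisors,
          if d ∣ p.1.val ∧ d ∣ p.2.val then n * d else 0 := by
        refine sum_le_sum fun p _ => (card_linear_zmod n p.1 p.2).trans ?_
        have hmem : n.gcd (p.1.val.gcd p.2.val) ∈ n.divisors :=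
          Nat.mem_divisors.2 ⟨Nat.gcd_dvd_left _ _, hn⟩
        refine le_trans ?_ (single_le_sum (fun d _ => Nat.zero_le _) hmem)
        rw [if_pos ⟨(Nat.gcd_dvd_right _ _).trans (Nat.gcd_dvd_left _ _),
          (Nat.gcd_dvd_right _ _).trans (Nat.gcd_dvd_right _ _)⟩]
    _ = ∑ d ∈ n.divisors, #{p : ZMod n × ZMod n | d ∣ p.1.val ∧ d ∣ p.2.val} * (n * d) := by
        rw [sum_comm]
        exact sum_congr rfl fun d _ => by rw [← sum_filter, sum_const, smul_eq_mul]
    _ ≤ ∑ d ∈ n.divisors, n ^ 2 * (n / d) := by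
        refine sum_le_sum fun d hd => ?_
        have hdn := Nat.dvd_of_mem_divisors hd
        calc _ ≤ (n / d) ^ 2 * (n * d) := Nat.mul_le_mul_right _ (card_filter_dvd_pair_le hdn)
          _ = (n / d) * n * (d * (n / d)) := by ring
          _ = n ^ 2 * (n / d) := by rw [Nat.mul_div_cancel' hdn]; ring
    _ = n ^ 2 * ∑ d ∈ n.divisors, d := by
        rw [← mul_sum, Nat.sum_div_divisors n (fun d => d)]

/-- The diagonal binary quadratic polynomial `A s² + α s + B v² + γ v`. -/
def binQuad {R : Type*} [CommRing R] (A α B γ : R) (p : R × R) : R :=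
  A * p.1 ^ 2 + α * p.1 + (B * p.2 ^ 2 + γ * p.2)

theorem card_binQuad_sub_eq_zero_le (n : ℕ) [NeZero n] {A B : ZMod n} (α γ : ZMod n)
    (h2 : IsUnit (2 : ZMod n)) (hA : IsUnit A) (hB : IsUnit B) :
    #{q : (ZMod n × ZMod n) × (ZMod n × ZMod n) |
      binQuad A α B γ q.2 - binQuad A α B γ q.1 = 0} ≤ n ^ 2 * ∑ d ∈ n.divisors, d := by
  refine le_trans (card_le_card_of_injOn (fun q => ((q.2.1 - q.1.1, q.2.2 - q.1.2),
    (α + A * (q.1.1 + q.2.1), γ + B * (q.1.2 + q.2.2)))) ?_ ?_) (card_hyperbolic_zeros_le n)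
  · rintro ⟨⟨s, v⟩, ⟨s', v'⟩⟩ h
    rw [mem_coe, mem_filter] at h ⊢
    refine ⟨mem_univ _, ?_⟩
    have h1 := h.2
    simp only [binQuad] at h1 ⊢
    rw [← h1]; ring
  · rintro ⟨⟨s, v⟩, ⟨s', v'⟩⟩ - ⟨⟨t, w⟩, ⟨t', w'⟩⟩ - h
    simp only [Prod.mk.injEq] at h
    obtain ⟨⟨h1, h3⟩, h4, h5⟩ := h
    have h6 := hA.mul_left_cancel (add_left_cancel h4)
    have h7 := hB.mul_left_cancel (add_left_cancel h5)
    have e1 : s = t := h2.mul_left_cancel (by linear_combination h6 - h1)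
    have e2 : v = w := h2.mul_left_cancel (by linear_combination h7 - h3)
    subst e1 e2
    rw [sub_left_inj] at h1 h3
    rw [h1, h3]

theorem card_binQuad_sub_eq_le (m : ℕ) [NeZero m] {A α : ZMod m} (B γ c : ZMod m)
    (hinj : Function.Injective fun s : ZMod m => A * s ^ 2 + α * s) :
    #{q : (ZMod m × ZMod m) × (ZMod m × ZMod m) |
      binQuad A α B γ q.2 - binQuad A α B γ q.1 = c} ≤ m ^ 3 := by
  calc _ ≤ #(univ : Finset ((ZMod m × ZMod m) × ZMod m)) := by
        refine card_le_card_of_injOn (fun q => (q.1, q.2.2)) (fun _ _ => by simp) ?_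
        rintro ⟨⟨s, v⟩, ⟨s', v'⟩⟩ h ⟨⟨t, w⟩, ⟨t', w'⟩⟩ h' heq
        rw [mem_coe, mem_filter] at h h'
        have h1 := h.2
        have h2 := h'.2
        simp only [binQuad] at h1 h2
        simp only [Prod.mk.injEq] at heq
        obtain ⟨⟨rfl, rfl⟩, rfl⟩ := heq
        have : s' = t' := hinj (by linear_combination h1 - h2)
        rw [this]
    _ = m ^ 3 := by
        simp only [card_univ, Fintype.card_prod, ZMod.card]; ring

theorem injective_quadratic_of_coprime {m A α : ℕ} [NeZero m]
    (h : ∀ p : ℕ, p.Prime → p ∣ m → p ∣ A ∧ ¬ p ∣ α) :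
    Function.Injective fun s : ZMod m => (A : ZMod m) * s ^ 2 + (α : ZMod m) * s := by
  intro s t hst
  have hunit : IsUnit ((A * (s.val + t.val) + α : ℕ) : ZMod m) := by
    rw [ZMod.isUnit_iff_coprime]
    refine Nat.Coprime.symm (Nat.coprime_of_dvd fun p hp hpm hpd => ?_)
    obtain ⟨h1, h2⟩ := h p hp hpm
    exact h2 ((Nat.dvd_add_right (h1.mul_right _)).1 hpd)
  push_cast [ZMod.natCast_val, ZMod.cast_id] at hunit
  refine hunit.mul_left_cancel ?_
  simp only at hst
  linear_combination hst

theorem exists_coprime_part (M : ℕ) {k : ℕ} (hk : 0 < k) :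
    ∃ k₁ k₂ : ℕ, k = k₁ * k₂ ∧ k₂.Coprime M ∧ ∀ p : ℕ, p.Prime → p ∣ k₁ → p ∣ M := by
  induction k using Nat.strong_induction_on with
  | _ k ih =>
    by_cases hc : k.Coprime M
    · exact ⟨1, k, (one_mul k).symm, hc, fun p hp h => absurd (Nat.dvd_one.1 h) hp.one_lt.ne'⟩
    · obtain ⟨p, hp, ⟨j, rfl⟩, hpM⟩ := Nat.Prime.not_coprime_iff_dvd.1 hc
      have hj : 0 < j := Nat.pos_of_mul_pos_left hk
      obtain ⟨k₁, k₂, rfl, h2, h3⟩ := ih j (lt_mul_left hj hp.one_lt) hj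
      refine ⟨p * k₁, k₂, (mul_assoc _ _ _).symm, h2, fun q hq hqd => ?_⟩
      rcases hq.dvd_mul.1 hqd with h | h
      · rwa [(Nat.prime_dvd_prime_iff_eq hq hp).1 h]
      · exact h3 q hq h

/-- `∑ 1/d` over the divisors `d` of `k` coprime to `M`. -/
noncomputable def coprimeDivisorSum (M k : ℕ) : ℝ :=
  ∑ d ∈ k.divisors with d.Coprime M, (1 / d : ℝ)

theorem card_binQuad_crt_le {m₁ m₂ : ℕ} [NeZero m₁] [NeZero m₂] (h : m₁.Coprime m₂)
    (A α B γ c : ℕ) :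
    #{q : (ZMod (m₁ * m₂) × ZMod (m₁ * m₂)) × (ZMod (m₁ * m₂) × ZMod (m₁ * m₂)) |
      binQuad (A : ZMod (m₁ * m₂)) α B γ q.2 - binQuad (A : ZMod (m₁ * m₂)) α B γ q.1 = c} ≤
    #{q : (ZMod m₁ × ZMod m₁) × (ZMod m₁ × ZMod m₁) |
      binQuad (A : ZMod m₁) α B γ q.2 - binQuad (A : ZMod m₁) α B γ q.1 = c} *
    #{q : (ZMod m₂ × ZMod m₂) × (ZMod m₂ × ZMod m₂) |
      binQuad (A : ZMod m₂) α B γ q.2 - binQuad (A : ZMod m₂) α B γ q.1 = c} := by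
  let e := ZMod.chineseRemainder h
  let f : ZMod (m₁ * m₂) →+* ZMod m₁ := (RingHom.fst _ _).comp e.toRingHom
  let g : ZMod (m₁ * m₂) →+* ZMod m₂ := (RingHom.snd _ _).comp e.toRingHom
  have hfg : ∀ x y, f x = f y → g x = g y → x = y := fun x y h1 h2 =>
    e.injective (Prod.ext h1 h2)
  rw [← card_product]
  refine card_le_card_of_injOn (fun q =>
    (((f q.1.1, f q.1.2), (f q.2.1, f q.2.2)), ((g q.1.1, g q.1.2), (g q.2.1, g q.2.2)))) ?_ ?_
  · rintro ⟨⟨s, v⟩, ⟨s', v'⟩⟩ hq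
    rw [mem_coe, mem_filter] at hq
    have h1 := hq.2
    simp only [binQuad] at h1
    rw [mem_coe, mem_product, mem_filter, mem_filter]
    refine ⟨⟨mem_univ _, ?_⟩, ⟨mem_univ _, ?_⟩⟩
    · have := congrArg f h1
      simpa only [binQuad, map_sub, map_add, map_mul, map_pow, map_natCast] using this
    · have := congrArg g h1
      simpa only [binQuad, map_sub, map_add, map_mul, map_pow, map_natCast] using this
  · rintro ⟨⟨s, v⟩, ⟨s', v'⟩⟩ - ⟨⟨t, w⟩, ⟨t', w'⟩⟩ - heq
    simp only [Prod.mk.injEq] at heq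
    obtain ⟨⟨⟨a1, a2⟩, a3, a4⟩, ⟨b1, b2⟩, b3, b4⟩ := heq
    rw [hfg _ _ a1 b1, hfg _ _ a2 b2, hfg _ _ a3 b3, hfg _ _ a4 b4]

theorem card_binQuad_sub_eq_le_coprimeDivisorSum {A α B γ C M k : ℕ} (hC : 0 < C) (hk : 0 < k)
    (hM : ∀ p : ℕ, p.Prime → p ∣ M → p ∣ A ∧ ¬ p ∣ α)
    (hM' : ∀ p : ℕ, p.Prime → ¬ p ∣ M → ¬ p ∣ 2 * A * B * C) (e : ℕ)
    [NeZero (2 * C * k)] :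
    (#{q : (ZMod (2 * C * k) × ZMod (2 * C * k)) × (ZMod (2 * C * k) × ZMod (2 * C * k)) |
      binQuad (A : ZMod (2 * C * k)) α B γ q.2 - binQuad (A : ZMod (2 * C * k)) α B γ q.1
        = (k * e : ℕ)} : ℝ) ≤
      (2 * C * k : ℝ) ^ 3 * coprimeDivisorSum M k := by
  obtain ⟨k₁, k₂, rfl, hcop, hk₁⟩ := exists_coprime_part M hk
  have hk1 : 0 < k₁ := Nat.pos_of_mul_pos_right hk
  have hk2 : 0 < k₂ := Nat.pos_of_mul_pos_left hk
  have hp1 : ∀ p : ℕ, p.Prime → p ∣ 2 * C * k₁ → p ∣ M := by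
    intro p hp hd
    by_contra hn
    rcases hp.dvd_mul.1 hd with h | h
    · exact hM' p hp hn (h.trans ⟨A * B, by ring⟩)
    · exact hn (hk₁ p hp h)
  have hp2 : ∀ p : ℕ, p.Prime → p ∣ k₂ → ¬ p ∣ 2 * A * B * C := fun p hp hd =>
    hM' p hp fun h => hp.one_lt.ne' (Nat.dvd_one.1 (hcop ▸ Nat.dvd_gcd hd h))
  have hco : (2 * C * k₁).Coprime k₂ := Nat.coprime_of_dvd fun p hp h1 h2 =>
    hp.one_lt.ne' (Nat.dvd_one.1 (hcop ▸ Nat.dvd_gcd h2 (hp1 p hp h1)))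
  have : NeZero (2 * C * k₁) := ⟨by positivity⟩
  have : NeZero k₂ := ⟨hk2.ne'⟩
  have hunit : ∀ x : ℕ, x ∣ 2 * A * B * C → IsUnit (x : ZMod k₂) := fun x hx =>
    (ZMod.isUnit_iff_coprime _ _).2 (Nat.Coprime.symm (Nat.coprime_of_dvd fun p hp h1 h2 =>
      hp2 p hp h1 (h2.trans hx)))
  have hmm : 2 * C * (k₁ * k₂) = 2 * C * k₁ * k₂ := by ring
  have key : ∀ m : ℕ, ∀ _ : NeZero m, m = 2 * C * k₁ * k₂ →
      #{q : (ZMod m × ZMod m) × (ZMod m × ZMod m) |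
        binQuad (A : ZMod m) α B γ q.2 - binQuad (A : ZMod m) α B γ q.1 = (k₁ * k₂ * e : ℕ)} ≤
      (2 * C * k₁) ^ 3 * (k₂ ^ 2 * ∑ d ∈ k₂.divisors, d) := by
    rintro m _ rfl
    refine (card_binQuad_crt_le hco A α B γ _).trans (Nat.mul_le_mul ?_ ?_)
    · exact card_binQuad_sub_eq_le _ _ _ _ (injective_quadratic_of_coprime fun p hp hd =>
        hM p hp (hp1 p hp hd))
    · have h0 : ((k₁ * k₂ * e : ℕ) : ZMod k₂) = 0 := by push_cast; simp
      rw [h0]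
      exact card_binQuad_sub_eq_zero_le k₂ _ _ (by exact_mod_cast hunit 2 ⟨A * B * C, by ring⟩)
        (hunit A ⟨2 * B * C, by ring⟩) (hunit B ⟨2 * A * C, by ring⟩)
  have hsum : ((∑ d ∈ k₂.divisors, d : ℕ) : ℝ) ≤ k₂ * coprimeDivisorSum M (k₁ * k₂) := by
    calc ((∑ d ∈ k₂.divisors, d : ℕ) : ℝ) = ∑ d ∈ k₂.divisors, (k₂ : ℝ) * (1 / d) := by
          rw [← Nat.sum_div_divisors k₂ (fun d => d)]
          push_cast
          refine sum_congr rfl fun d hd => ?_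
          rw [Nat.cast_div (Nat.dvd_of_mem_divisors hd)
            (Nat.cast_ne_zero.2 (Nat.pos_of_mem_divisors hd).ne')]
          ring
      _ = k₂ * ∑ d ∈ k₂.divisors, (1 / d : ℝ) := by rw [mul_sum]
      _ ≤ _ := by
          refine mul_le_mul_of_nonneg_left ?_ (Nat.cast_nonneg _)
          refine sum_le_sum_of_subset_of_nonneg (fun d hd => ?_) fun d _ _ => by positivity
          have hdd := Nat.dvd_of_mem_divisors hd
          exact mem_filter.2 ⟨Nat.mem_divisors.2 ⟨hdd.mul_left _, hk.ne'⟩,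
            Nat.Coprime.coprime_dvd_left hdd hcop⟩
  calc _ ≤ (((2 * C * k₁) ^ 3 * (k₂ ^ 2 * ∑ d ∈ k₂.divisors, d) : ℕ) : ℝ) := by
        exact_mod_cast key _ _ hmm
    _ = (2 * C * k₁ : ℝ) ^ 3 * (k₂ ^ 2 * ((∑ d ∈ k₂.divisors, d : ℕ) : ℝ)) := by push_cast; ring
    _ ≤ (2 * C * k₁ : ℝ) ^ 3 * (k₂ ^ 2 * (k₂ * coprimeDivisorSum M (k₁ * k₂))) := by gcongr
    _ = _ := by push_cast; ring

/-- Pairs of points of the square `[0, L)²`. -/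
def pairBox (L : ℕ) : Finset ((ℕ × ℕ) × (ℕ × ℕ)) :=
  (range L ×ˢ range L) ×ˢ (range L ×ˢ range L)

theorem mem_pairBox {L : ℕ} {q : (ℕ × ℕ) × (ℕ × ℕ)} :
    q ∈ pairBox L ↔ (q.1.1 < L ∧ q.1.2 < L) ∧ (q.2.1 < L ∧ q.2.2 < L) := by
  simp [pairBox]

theorem card_pairBox (L : ℕ) : #(pairBox L) = L ^ 4 := by
  simp only [pairBox, card_product, card_range]; ring

/-- The difference of the values of `binQuad` at the two points of a pair. -/
def quadDiff (A α B γ : ℕ) (q : (ℕ × ℕ) × (ℕ × ℕ)) : ℤ :=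
  binQuad (A : ℤ) α B γ ((q.2.1 : ℤ), (q.2.2 : ℤ)) - binQuad (A : ℤ) α B γ ((q.1.1 : ℤ), (q.1.2 : ℤ))

theorem abs_quadratic_sub_le {A α s t m L : ℕ} (hs : s ≤ L) (ht : t ≤ L)
    (h : |(s : ℤ) - t| ≤ m) :
    |((A : ℤ) * s ^ 2 + α * s) - (A * t ^ 2 + α * t)| ≤ m * (2 * A * L + α) := by
  have h1 : ((A : ℤ) * s ^ 2 + α * s) - (A * t ^ 2 + α * t)
      = (s - t) * (A * (s + t) + α) := by ring
  rw [h1, abs_mul]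
  refine mul_le_mul h ?_ (abs_nonneg _) (by positivity)
  rw [abs_of_nonneg (by positivity)]
  have h2 : (A : ℤ) * (s + t) ≤ A * (L + L) := by gcongr
  linarith

theorem abs_quadDiff_sub_le {A α B γ m L : ℕ} {q q' : (ℕ × ℕ) × (ℕ × ℕ)}
    (hq : q ∈ pairBox L) (hq' : q' ∈ pairBox L)
    (h11 : |(q'.1.1 : ℤ) - q.1.1| ≤ m) (h12 : |(q'.1.2 : ℤ) - q.1.2| ≤ m)
    (h21 : |(q'.2.1 : ℤ) - q.2.1| ≤ m) (h22 : |(q'.2.2 : ℤ) - q.2.2| ≤ m) :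
    |quadDiff A α B γ q' - quadDiff A α B γ q| ≤
      m * L * (4 * A + 2 * α + 4 * B + 2 * γ) := by
  rw [mem_pairBox] at hq hq'
  have hL : (1 : ℤ) ≤ L := by exact_mod_cast (Nat.zero_le _).trans_lt hq.1.1
  have a1 := abs_quadratic_sub_le (A := A) (α := α) hq'.1.1.le hq.1.1.le h11
  have a2 := abs_quadratic_sub_le (A := B) (α := γ) hq'.1.2.le hq.1.2.le h12
  have a3 := abs_quadratic_sub_le (A := A) (α := α) hq'.2.1.le hq.2.1.le h21
  have a4 := abs_quadratic_sub_le (A := B) (α := γ) hq'.2.2.le hq.2.2.le h22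
  have b : ∀ x : ℤ, 0 ≤ x → (m : ℤ) * x ≤ m * L * x := fun x hx => by
    have : (m : ℤ) * x * 1 ≤ m * x * L := mul_le_mul_of_nonneg_left hL (by positivity)
    linarith
  have b1 := b α (by positivity)
  have b2 := b γ (by positivity)
  simp only [quadDiff, binQuad]
  rw [abs_le] at a1 a2 a3 a4 ⊢
  constructor <;> nlinarith

theorem abs_sub_le_of_div_eq {m s t : ℕ} (hm : 0 < m) (h : s / m = t / m) :
    |(s : ℤ) - t| ≤ m := by
  have h1 := Nat.div_add_mod s m
  have h2 := Nat.div_add_mod t m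
  have h3 := Nat.mod_lt s hm
  have h4 := Nat.mod_lt t hm
  rw [h] at h1
  rw [abs_le]
  constructor <;> zify at h1 h2 h3 h4 ⊢ <;> linarith [Int.emod_nonneg s (b := m) (by omega), Int.emod_nonneg t (b := m) (by omega)]

theorem eq_of_div_eq_of_cast_eq {m s t : ℕ} (h : s / m = t / m)
    (h' : (s : ZMod m) = t) : s = t := by
  rw [ZMod.natCast_eq_natCast_iff'] at h'
  rw [← Nat.div_add_mod s m, ← Nat.div_add_mod t m, h, h']

theorem card_filter_mul_pow_le {A α B γ m L L' : ℕ} [NeZero m] (hL : L + m ≤ L') (c : ℕ)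
    (lo hi : ℤ) :
    #{q ∈ pairBox L | (quadDiff A α B γ q : ZMod m) = c ∧
        lo ≤ quadDiff A α B γ q ∧ quadDiff A α B γ q ≤ hi} * m ^ 4 ≤
    #{q ∈ pairBox L' | lo - m * L' * (4 * A + 2 * α + 4 * B + 2 * γ) ≤ quadDiff A α B γ q ∧
        quadDiff A α B γ q ≤ hi + m * L' * (4 * A + 2 * α + 4 * B + 2 * γ)} *
    #{q : (ZMod m × ZMod m) × (ZMod m × ZMod m) |
      binQuad (A : ZMod m) α B γ q.2 - binQuad (A : ZMod m) α B γ q.1 = c} := by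
  have hm : 0 < m := Nat.pos_of_ne_zero (NeZero.ne m)
  let r : (ℕ × ℕ) × (ℕ × ℕ) → (ℕ × ℕ) × (ℕ × ℕ) → Prop := fun q q' =>
    (q.1.1 / m = q'.1.1 / m ∧ q.1.2 / m = q'.1.2 / m) ∧
      (q.2.1 / m = q'.2.1 / m ∧ q.2.2 / m = q'.2.2 / m)
  have hdiv : ∀ s i, i < m → (m * (s / m) + i) / m = s / m := fun s i hi => by
    rw [Nat.mul_add_div hm, Nat.div_eq_of_lt hi, add_zero]
  have hlt : ∀ s i, s < L → i < m → m * (s / m) + i < L' := fun s i hs hi => by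
    have := Nat.mul_div_le s m
    omega
  classical
  refine card_mul_le_card_mul r (fun q hq => ?_) (fun q' hq' => ?_)
  · rw [mem_filter] at hq
    obtain ⟨hq, -, hlo, hhi⟩ := hq
    have hqb := mem_pairBox.1 hq
    rw [← card_pairBox m]
    refine card_le_card_of_injOn (fun i => ((m * (q.1.1 / m) + i.1.1, m * (q.1.2 / m) + i.1.2),
      (m * (q.2.1 / m) + i.2.1, m * (q.2.2 / m) + i.2.2))) (fun i hi => ?_) ?_
    · rw [mem_coe, mem_pairBox] at hi
      rw [mem_coe, bipartiteAbove, mem_filter, mem_filter]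
      set q' : (ℕ × ℕ) × (ℕ × ℕ) := ((m * (q.1.1 / m) + i.1.1, m * (q.1.2 / m) + i.1.2),
        (m * (q.2.1 / m) + i.2.1, m * (q.2.2 / m) + i.2.2)) with hq'
      have hr : r q q' := ⟨⟨(hdiv _ _ hi.1.1).symm, (hdiv _ _ hi.1.2).symm⟩,
        (hdiv _ _ hi.2.1).symm, (hdiv _ _ hi.2.2).symm⟩
      have hq'b : q' ∈ pairBox L' := mem_pairBox.2
        ⟨⟨hlt _ _ hqb.1.1 hi.1.1, hlt _ _ hqb.1.2 hi.1.2⟩,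
          hlt _ _ hqb.2.1 hi.2.1, hlt _ _ hqb.2.2 hi.2.2⟩
      have hqb' : q ∈ pairBox L' := mem_pairBox.2 (by omega)
      have hv := abs_quadDiff_sub_le (A := A) (α := α) (B := B) (γ := γ) hqb' hq'b
        (abs_sub_le_of_div_eq hm hr.1.1.symm) (abs_sub_le_of_div_eq hm hr.1.2.symm)
        (abs_sub_le_of_div_eq hm hr.2.1.symm) (abs_sub_le_of_div_eq hm hr.2.2.symm)
      rw [abs_le] at hv
      exact ⟨⟨hq'b, by linarith, by linarith⟩, hr⟩
    · rintro ⟨⟨i, j⟩, ⟨i', j'⟩⟩ - ⟨⟨k, l⟩, ⟨k', l'⟩⟩ - h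
      simpa using h
  · refine card_le_card_of_injOn (fun q => (((q.1.1 : ZMod m), (q.1.2 : ZMod m)),
      ((q.2.1 : ZMod m), (q.2.2 : ZMod m)))) (fun q hq => ?_) ?_
    · rw [mem_coe, bipartiteBelow, mem_filter, mem_filter] at hq
      rw [mem_coe, mem_filter]
      refine ⟨mem_univ _, ?_⟩
      rw [← hq.1.2.1]
      simp only [quadDiff, binQuad]
      push_cast
      ring
    · rintro q hq p hp heq
      rw [mem_coe, bipartiteBelow, mem_filter] at hq hp
      have h1 := hq.2
      have h2 := hp.2
      simp only [Prod.mk.injEq] at heq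
      exact Prod.ext
        (Prod.ext (eq_of_div_eq_of_cast_eq (h1.1.1.trans h2.1.1.symm) heq.1.1)
          (eq_of_div_eq_of_cast_eq (h1.1.2.trans h2.1.2.symm) heq.1.2))
        (Prod.ext (eq_of_div_eq_of_cast_eq (h1.2.1.trans h2.2.1.symm) heq.2.1)
          (eq_of_div_eq_of_cast_eq (h1.2.2.trans h2.2.2.symm) heq.2.2))

theorem card_filter_le_coprimeDivisorSum {A α B γ C M k L L' : ℕ} (hC : 0 < C) (hk : 0 < k)
    (hM : ∀ p : ℕ, p.Prime → p ∣ M → p ∣ A ∧ ¬ p ∣ α)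
    (hM' : ∀ p : ℕ, p.Prime → ¬ p ∣ M → ¬ p ∣ 2 * A * B * C)
    (hL : L + 2 * C * k ≤ L') (e : ℕ) (lo hi : ℤ) :
    (#{q ∈ pairBox L | ((2 * C * k : ℕ) : ℤ) ∣ quadDiff A α B γ q - k * e ∧
        k * lo ≤ quadDiff A α B γ q ∧ quadDiff A α B γ q ≤ k * hi} : ℝ) ≤
    #{q ∈ pairBox L' |
        k * (lo - 2 * C * L' * (4 * A + 2 * α + 4 * B + 2 * γ)) ≤ quadDiff A α B γ q ∧
        quadDiff A α B γ q ≤ k * (hi + 2 * C * L' * (4 * A + 2 * α + 4 * B + 2 * γ))} *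
      (coprimeDivisorSum M k / (2 * C * k)) := by
  have : NeZero (2 * C * k) := ⟨by positivity⟩
  have h1 := card_filter_mul_pow_le (A := A) (α := α) (B := B) (γ := γ) hL (k * e)
    (k * lo) (k * hi)
  have h2 := card_binQuad_sub_eq_le_coprimeDivisorSum (α := α) (γ := γ) hC hk hM hM' e
  have e1 : ∀ q, ((quadDiff A α B γ q : ℤ) : ZMod (2 * C * k)) = ((k * e : ℕ) : ZMod (2 * C * k)) ↔
      ((2 * C * k : ℕ) : ℤ) ∣ quadDiff A α B γ q - k * e := fun q => by
    rw [← Int.cast_natCast (k * e), ← sub_eq_zero, ← Int.cast_sub, ZMod.intCast_zmod_eq_zero_iff_dvd]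
    push_cast
    rfl
  have e2 : (k : ℤ) * lo - (2 * C * k : ℕ) * L' * (4 * A + 2 * α + 4 * B + 2 * γ) =
      k * (lo - 2 * C * L' * (4 * A + 2 * α + 4 * B + 2 * γ)) := by push_cast; ring
  have e3 : (k : ℤ) * hi + (2 * C * k : ℕ) * L' * (4 * A + 2 * α + 4 * B + 2 * γ) =
      k * (hi + 2 * C * L' * (4 * A + 2 * α + 4 * B + 2 * γ)) := by push_cast; ring
  simp only [e1, e2, e3] at h1
  generalize #{q ∈ pairBox L | ((2 * C * k : ℕ) : ℤ) ∣ quadDiff A α B γ q - k * e ∧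
        k * lo ≤ quadDiff A α B γ q ∧ quadDiff A α B γ q ≤ k * hi} = n at h1 ⊢
  generalize #{q ∈ pairBox L' |
        k * (lo - 2 * C * L' * (4 * A + 2 * α + 4 * B + 2 * γ)) ≤ quadDiff A α B γ q ∧
        quadDiff A α B γ q ≤ k * (hi + 2 * C * L' * (4 * A + 2 * α + 4 * B + 2 * γ))} = n' at h1 ⊢
  have hm : (0 : ℝ) < 2 * C * k := by positivity
  have h3 : (n : ℝ) * (2 * C * k) ^ 4 ≤ n' * ((2 * C * k) ^ 3 * coprimeDivisorSum M k) :=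
    le_trans (by exact_mod_cast h1) (mul_le_mul_of_nonneg_left h2 (Nat.cast_nonneg _))
  rw [← mul_div_assoc, le_div_iff₀ hm]
  refine le_of_mul_le_mul_right ?_ (pow_pos hm 3)
  linarith

theorem card_multiples_le {s : Finset ℕ} {d : ℕ} (hd : 0 < d) {a b : ℝ} (ha : 0 ≤ a) (hab : a ≤ b)
    (h : ∀ k ∈ s, d ∣ k ∧ a ≤ k ∧ (k : ℝ) ≤ b) : (#s : ℝ) ≤ (b - a) / d + 1 := by
  have hd' : (0 : ℝ) < d := by exact_mod_cast hd
  have h1 : #s ≤ #(Icc ⌈a / d⌉₊ ⌊b / d⌋₊) := by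
    refine card_le_card_of_injOn (fun k => k / d) (fun k hk => ?_) (fun k hk l hl hkl => ?_)
    · obtain ⟨⟨j, rfl⟩, h2, h3⟩ := h k hk
      rw [Nat.cast_mul] at h2 h3
      simp only [mem_coe, mem_Icc, Nat.mul_div_cancel_left _ hd]
      exact ⟨Nat.ceil_le.2 ((div_le_iff₀' hd').2 h2), Nat.le_floor ((le_div_iff₀' hd').2 h3)⟩
    · rw [← Nat.div_mul_cancel (h k hk).1, ← Nat.div_mul_cancel (h l hl).1]
      exact congrArg (· * d) hkl
  rw [Nat.card_Icc] at h1
  have h2 : (0 : ℝ) ≤ (b - a) / d := div_nonneg (sub_nonneg.2 hab) hd'.le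
  rcases le_or_gt ⌈a / d⌉₊ (⌊b / d⌋₊ + 1) with h3 | h3
  · have h4 : (#s : ℝ) ≤ ⌊b / d⌋₊ + 1 - ⌈a / d⌉₊ := by
      have : #s + ⌈a / d⌉₊ ≤ ⌊b / d⌋₊ + 1 := by omega
      have : (#s : ℝ) + ⌈a / d⌉₊ ≤ ⌊b / d⌋₊ + 1 := by exact_mod_cast this
      linarith
    have h5 : (⌊b / d⌋₊ : ℝ) ≤ b / d := Nat.floor_le (div_nonneg (ha.trans hab) hd'.le)
    have h6 : a / d ≤ ⌈a / d⌉₊ := Nat.le_ceil _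
    rw [sub_div]
    linarith
  · have : #s = 0 := by omega
    rw [this, Nat.cast_zero]
    linarith

theorem sum_inv_multiples_le {d T : ℕ} (hd : 0 < d) {lo hi h : ℝ} (hlo : 0 < lo) (hhi : lo ≤ hi)
    (hh : 0 < h) :
    ∑ k ∈ Ico 1 T with d ∣ k ∧ k * lo ≤ h ∧ h ≤ k * hi, (1 / k : ℝ) ≤
      (hi / lo - 1) / d + hi / h := by
  have hhi' : 0 < hi := hlo.trans_le hhi
  have hcard : (#{k ∈ Ico 1 T | d ∣ k ∧ k * lo ≤ h ∧ h ≤ k * hi} : ℝ) ≤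
      (h / lo - h / hi) / d + 1 := by
    refine card_multiples_le hd (by positivity) (by gcongr) fun k hk => ?_
    rw [mem_filter] at hk
    exact ⟨hk.2.1, (div_le_iff₀ hhi').2 hk.2.2.2, (le_div_iff₀ hlo).2 hk.2.2.1⟩
  calc _ ≤ ∑ k ∈ Ico 1 T with d ∣ k ∧ k * lo ≤ h ∧ h ≤ k * hi, hi / h := by
        refine sum_le_sum fun k hk => ?_
        rw [mem_filter, mem_Ico] at hk
        have hk0 : (0 : ℝ) < k := by exact_mod_cast hk.1.1
        rw [div_le_div_iff₀ hk0 hh]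
        linarith [hk.2.2.2]
    _ ≤ ((h / lo - h / hi) / d + 1) * (hi / h) := by
        rw [sum_const, nsmul_eq_mul]
        gcongr
    _ = _ := by
        have : (d : ℝ) ≠ 0 := by positivity
        field_simp

theorem sum_coprime_inv_sq_le {M w : ℕ} (hw : 0 < w) (hM : ∀ p : ℕ, p.Prime → p ≤ w → p ∣ M)
    (T : ℕ) : ∑ d ∈ Ico 1 T with d.Coprime M, (1 / (d : ℝ) ^ 2 : ℝ) ≤ 1 + 1 / (w : ℝ) := by
  have hsub : {d ∈ Ico 1 T | d.Coprime M} ⊆ insert 1 (Ioc w (max w T)) := by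
    intro d hd
    rw [mem_filter, mem_Ico] at hd
    rw [mem_insert, mem_Ioc]
    by_cases h1 : d = 1
    · exact Or.inl h1
    · refine Or.inr ⟨?_, hd.1.2.le.trans (le_max_right _ _)⟩
      by_contra hle
      have hp := Nat.minFac_prime h1
      have h2 := hM _ hp ((Nat.minFac_le hd.1.1).trans (not_lt.1 hle))
      have h3 := Nat.dvd_gcd (Nat.minFac_dvd d) h2
      rw [hd.2] at h3
      exact hp.one_lt.ne' (Nat.dvd_one.1 h3)
  calc _ ≤ ∑ d ∈ insert 1 (Ioc w (max w T)), (1 / (d : ℝ) ^ 2) :=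
        sum_le_sum_of_subset_of_nonneg hsub fun _ _ _ => by positivity
    _ ≤ 1 + ∑ d ∈ Ioc w (max w T), ((d : ℝ) ^ 2)⁻¹ := by
        rw [sum_insert (by simp; omega)]
        simp
    _ ≤ 1 + ((w : ℝ)⁻¹ - ((max w T : ℕ) : ℝ)⁻¹) := by
        gcongr
        exact sum_Ioc_inv_sq_le_sub hw.ne' (le_max_left _ _)
    _ ≤ 1 + 1 / w := by
        rw [one_div]
        have : (0 : ℝ) ≤ ((max w T : ℕ) : ℝ)⁻¹ := by positivity
        linarith

theorem coprimeDivisorSum_div_eq {M k T : ℕ} (hk : k ∈ Ico 1 T) :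
    coprimeDivisorSum M k / k =
      ∑ d ∈ Ico 1 T with d.Coprime M, if d ∣ k then 1 / (d : ℝ) * (1 / k) else 0 := by
  rw [mem_Ico] at hk
  have hset : {d ∈ k.divisors | d.Coprime M} = {d ∈ {d ∈ Ico 1 T | d.Coprime M} | d ∣ k} := by
    ext d
    simp only [mem_filter, Nat.mem_divisors, mem_Ico]
    constructor
    · rintro ⟨⟨h1, -⟩, h2⟩
      exact ⟨⟨⟨Nat.pos_of_dvd_of_pos h1 hk.1, (Nat.le_of_dvd hk.1 h1).trans_lt hk.2⟩, h2⟩, h1⟩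
    · rintro ⟨⟨-, h2⟩, h1⟩
      exact ⟨⟨h1, by omega⟩, h2⟩
  rw [← sum_filter, coprimeDivisorSum, hset, sum_div]
  exact sum_congr rfl fun d _ => by ring

theorem sum_coprimeDivisorSum_div_le {M w T : ℕ} (hw : 0 < w)
    (hM : ∀ p : ℕ, p.Prime → p ≤ w → p ∣ M) {lo hi h : ℝ} (hlo : 0 < lo) (hhi : lo ≤ hi)
    (hh : lo ≤ h) :
    ∑ k ∈ (Ico 1 T : Finset ℕ) with ((k : ℕ) : ℝ) * lo ≤ h ∧ h ≤ k * hi, coprimeDivisorSum M k / k ≤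
      (hi / lo - 1) * (1 + 1 / (w : ℝ)) + (1 + Real.log (h / lo)) * (hi / h) := by
  have hh' : 0 < h := hlo.trans_le hh
  have hhi' : 0 < hi := hlo.trans_le hhi
  have hθ : 0 ≤ hi / lo - 1 := by rw [sub_nonneg, one_le_div hlo]; exact hhi
  calc _ = ∑ d ∈ Ico 1 T with d.Coprime M, 1 / (d : ℝ) *
        ∑ k ∈ Ico 1 T with d ∣ k ∧ ((k : ℕ) : ℝ) * lo ≤ h ∧ h ≤ k * hi, (1 / k : ℝ) := by
        rw [sum_congr rfl fun k hk => coprimeDivisorSum_div_eq (M := M) (mem_filter.1 hk).1,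
          sum_comm]
        refine sum_congr rfl fun d _ => ?_
        rw [mul_sum, ← sum_filter, filter_filter]
        exact sum_congr (filter_congr fun k _ => and_comm) fun _ _ => rfl
    _ ≤ ∑ d ∈ Ico 1 T with d.Coprime M, ((hi / lo - 1) * (1 / (d : ℝ) ^ 2) +
          if d ≤ ⌊h / lo⌋₊ then (d : ℝ)⁻¹ * (hi / h) else 0) := by
        refine sum_le_sum fun d hd => ?_
        rw [mem_filter, mem_Ico] at hd
        have hd0 : (0 : ℝ) < d := by exact_mod_cast hd.1.1
        split_ifs with hdl
        · calc _ ≤ 1 / (d : ℝ) * ((hi / lo - 1) / d + hi / h) := by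
                gcongr
                exact sum_inv_multiples_le hd.1.1 hlo hhi hh'
            _ = _ := by field_simp
        · rw [filter_false_of_mem, sum_empty, mul_zero]
          · positivity
          · rintro k hk ⟨h1, h2, -⟩
            refine hdl (Nat.le_floor ((le_div_iff₀ hlo).2 (le_trans ?_ h2)))
            have : d ≤ k := Nat.le_of_dvd (mem_Ico.1 hk).1 h1
            gcongr
    _ ≤ (hi / lo - 1) * (1 + 1 / w) + (∑ d ∈ Icc 1 ⌊h / lo⌋₊, (d : ℝ)⁻¹) * (hi / h) := by
        rw [sum_add_distrib, ← mul_sum]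
        refine add_le_add (mul_le_mul_of_nonneg_left (sum_coprime_inv_sq_le hw hM T) hθ) ?_
        rw [← sum_filter, sum_mul]
        refine sum_le_sum_of_subset_of_nonneg (fun d hd => ?_) fun _ _ _ => by positivity
        simp only [mem_filter, mem_Ico] at hd
        exact mem_Icc.2 ⟨hd.1.1.1, hd.2⟩
    _ ≤ _ := by
        gcongr
        have h1 := harmonic_floor_le_one_add_log (h / lo) ((one_le_div hlo).2 hh)
        rw [harmonic_eq_sum_Icc] at h1
        push_cast at h1
        exact h1

theorem one_add_log_mul_le {lo hi h : ℝ} (hlo : 0 < lo) (hhi : lo ≤ hi) (hhi2 : hi ≤ 2 * lo)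
    (hh : lo ≤ h) : (1 + Real.log (h / lo)) * (hi / h) ≤ 2 := by
  have hh' : 0 < h := hlo.trans_le hh
  have h1 : Real.log (h / lo) ≤ h / lo - 1 := Real.log_le_sub_one_of_pos (by positivity)
  have hhi' : 0 < hi := hlo.trans_le hhi
  calc _ ≤ (h / lo) * (hi / h) := by gcongr; linarith
    _ = hi / lo := by field_simp
    _ ≤ 2 := (div_le_iff₀ hlo).2 hhi2

theorem one_add_log_mul_le_sqrt {lo hi h : ℝ} (hlo : 0 < lo) (hhi : lo ≤ hi) (hhi2 : hi ≤ 2 * lo)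
    (hh : lo ≤ h) : (1 + Real.log (h / lo)) * (hi / h) ≤ 4 * Real.sqrt (lo / h) := by
  have hh' : 0 < h := hlo.trans_le hh
  have hhi' : 0 < hi := hlo.trans_le hhi
  have hs : 0 < Real.sqrt (h / lo) := Real.sqrt_pos.2 (by positivity)
  have h1 : Real.log (h / lo) ≤ 2 * (Real.sqrt (h / lo) - 1) := by
    have := Real.log_le_sub_one_of_pos hs
    rw [Real.log_sqrt (by positivity)] at this
    linarith
  have h2 : Real.sqrt (lo / h) = (Real.sqrt (h / lo))⁻¹ := by
    rw [← Real.sqrt_inv, inv_div]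
  have h3 : h / lo = Real.sqrt (h / lo) ^ 2 := (Real.sq_sqrt (by positivity)).symm
  calc _ ≤ (2 * Real.sqrt (h / lo)) * (2 * lo / h) := by
        gcongr
        linarith
    _ = 4 * Real.sqrt (h / lo) * (h / lo)⁻¹ := by field_simp; ring
    _ = 4 * Real.sqrt (lo / h) := by
        rw [h2]
        nth_rw 2 [h3]
        field_simp

theorem sq_card_le_card_image_mul {ι κ : Type*} [DecidableEq κ] (s : Finset ι) (f : ι → κ) :
    #s ^ 2 ≤ #(s.image f) * #{z ∈ s ×ˢ s | f z.1 = f z.2} := by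
  have h1 : #s = ∑ n ∈ s.image f, #{i ∈ s | f i = n} :=
    card_eq_sum_card_fiberwise fun i hi => mem_coe.2 (mem_image_of_mem f hi)
  have h2 : #{z ∈ s ×ˢ s | f z.1 = f z.2} = ∑ n ∈ s.image f, #{i ∈ s | f i = n} ^ 2 := by
    rw [card_eq_sum_card_fiberwise (f := fun z => f z.1) (t := s.image f) fun z hz =>
      mem_coe.2 (mem_image_of_mem f (mem_product.1 (mem_filter.1 hz).1).1)]
    refine sum_congr rfl fun n _ => ?_
    rw [sq, ← card_product]
    congr 1
    ext z
    simp only [mem_filter, mem_product]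
    constructor
    · rintro ⟨⟨⟨h1, h2⟩, h3⟩, h4⟩
      exact ⟨⟨h1, h4⟩, h2, h3 ▸ h4⟩
    · rintro ⟨⟨h1, h4⟩, h2, h3⟩
      exact ⟨⟨⟨h1, h2⟩, h4.trans h3.symm⟩, h4⟩
  rw [h2]
  nth_rw 1 [h1]
  exact sq_sum_le_card_mul_sum_sq

/-- The ternary polynomial `A s² + α s + B v² + γ v + C x² + δ x` at `((s, v), x)`. -/
def ternQuad (A α B γ C δ : ℕ) (z : (ℕ × ℕ) × ℕ) : ℕ :=
  A * z.1.1 ^ 2 + α * z.1.1 + (B * z.1.2 ^ 2 + γ * z.1.2) + (C * z.2 ^ 2 + δ * z.2)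

/-- The box `[0, L)² × [X, X + T)`. -/
def ternBox (L X T : ℕ) : Finset ((ℕ × ℕ) × ℕ) :=
  (range L ×ˢ range L) ×ˢ Ico X (X + T)

theorem mem_ternBox {L X T : ℕ} {z : (ℕ × ℕ) × ℕ} :
    z ∈ ternBox L X T ↔ (z.1.1 < L ∧ z.1.2 < L) ∧ X ≤ z.2 ∧ z.2 < X + T := by
  simp [ternBox]

theorem card_ternBox (L X T : ℕ) : #(ternBox L X T) = L ^ 2 * T := by
  simp only [ternBox, card_product, card_range, Nat.card_Ico, Nat.add_sub_cancel_left]; ring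

theorem quadDiff_of_ternQuad_eq {A α B γ C δ : ℕ} {z z' : (ℕ × ℕ) × ℕ}
    (h : ternQuad A α B γ C δ z = ternQuad A α B γ C δ z') :
    quadDiff A α B γ (z.1, z'.1) = (z.2 - z'.2) * (δ + C * (z.2 + z'.2)) := by
  simp only [ternQuad] at h
  simp only [quadDiff, binQuad]
  zify at h
  linear_combination (-1 : ℤ) * h

/-- Pairs of points at which `ternQuad` may take equal values when the third coordinates lie in
`[X, X + T)` and differ by `k`. -/
def shiftPairs (A α B γ C δ L X T k : ℕ) : Finset ((ℕ × ℕ) × (ℕ × ℕ)) :=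
  {q ∈ pairBox L | ((2 * C * k : ℕ) : ℤ) ∣ quadDiff A α B γ q - k * ((δ + C * k : ℕ) : ℤ) ∧
    k * ((2 * C * X : ℕ) : ℤ) ≤ quadDiff A α B γ q ∧
    quadDiff A α B γ q ≤ k * ((2 * C * (X + T) + δ : ℕ) : ℤ)}

theorem card_ternQuad_eq_gt_le {A α B γ C δ L X T : ℕ} (hC : 0 < C) :
    #{z ∈ ternBox L X T ×ˢ ternBox L X T |
      ternQuad A α B γ C δ z.1 = ternQuad A α B γ C δ z.2 ∧ z.2.2 < z.1.2} ≤
    ∑ k ∈ Ico 1 T, #(shiftPairs A α B γ C δ L X T k) := by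
  rw [card_eq_sum_card_fiberwise (f := fun z => z.1.2 - z.2.2) (t := Ico 1 T)]
  · refine sum_le_sum fun k hk => card_le_card_of_injOn (fun z => (z.1.1, z.2.1)) ?_ ?_
    · rintro ⟨⟨p, x⟩, p', x'⟩ hz
      rw [mem_coe, mem_filter, mem_filter, mem_product, mem_ternBox, mem_ternBox] at hz
      obtain ⟨⟨⟨⟨hp, h1, h2⟩, hp', h3, h4⟩, h5, h6⟩, h7⟩ := hz
      dsimp only at hp hp' h1 h2 h3 h4 h5 h6 h7
      have h8 := quadDiff_of_ternQuad_eq h5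
      obtain rfl : x = x' + k := by omega
      dsimp only at h8
      rw [mem_coe, shiftPairs, mem_filter, mem_pairBox]
      dsimp only
      refine ⟨⟨hp, hp'⟩, ⟨x', ?_⟩, ?_, ?_⟩
      · rw [h8]; push_cast; ring
      · rw [h8]
        have e : ((x' + k : ℕ) : ℤ) - x' = k := by push_cast; ring
        rw [e]
        refine mul_le_mul_of_nonneg_left ?_ (by positivity)
        norm_cast
        nlinarith [Nat.mul_le_mul_left C h3, Nat.zero_le (C * k)]
      · rw [h8]
        have e : ((x' + k : ℕ) : ℤ) - x' = k := by push_cast; ring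
        rw [e]
        refine mul_le_mul_of_nonneg_left ?_ (by positivity)
        norm_cast
        nlinarith [Nat.mul_le_mul_left C h2.le, Nat.mul_le_mul_left C h4.le]
    · rintro ⟨⟨p, x⟩, p', x'⟩ hz ⟨⟨r, y⟩, r', y'⟩ hz' hzz
      rw [mem_coe, mem_filter, mem_filter] at hz hz'
      obtain ⟨⟨-, h5, h6⟩, h7⟩ := hz
      obtain ⟨⟨-, h5', h6'⟩, h7'⟩ := hz'
      dsimp only at h5 h6 h7 h5' h6' h7' hzz
      rw [Prod.mk.injEq] at hzz
      obtain ⟨rfl, rfl⟩ := hzz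
      have h8 := quadDiff_of_ternQuad_eq h5
      have h8' := quadDiff_of_ternQuad_eq h5'
      dsimp only at h8 h8'
      obtain rfl : x = x' + k := by omega
      obtain rfl : y = y' + k := by omega
      rw [h8] at h8'
      have hk' : (0 : ℤ) < k := by exact_mod_cast (mem_Ico.1 hk).1
      have hC' : (0 : ℤ) < C := by exact_mod_cast hC
      have h9 : (2 * C * k : ℤ) * x' = 2 * C * k * y' := by
        push_cast at h8'
        linear_combination h8'
      have h10 : (x' : ℤ) = y' := mul_left_cancel₀ (by positivity) h9
      obtain rfl : x' = y' := by exact_mod_cast h10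
      rfl
  · intro z hz
    rw [mem_coe, mem_filter, mem_product, mem_ternBox, mem_ternBox] at hz
    simp only [mem_coe, mem_Ico]
    omega

theorem card_ternQuad_eq_le {A α B γ C δ L X T : ℕ} (hC : 0 < C) :
    #{z ∈ ternBox L X T ×ˢ ternBox L X T |
      ternQuad A α B γ C δ z.1 = ternQuad A α B γ C δ z.2} ≤
    T * #{q ∈ pairBox L | quadDiff A α B γ q = 0} +
      2 * ∑ k ∈ Ico 1 T, #(shiftPairs A α B γ C δ L X T k) := by
  have hgt := card_ternQuad_eq_gt_le (A := A) (α := α) (B := B) (γ := γ) (δ := δ) (L := L)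
    (X := X) (T := T) hC
  have hlt : #{z ∈ ternBox L X T ×ˢ ternBox L X T |
      ternQuad A α B γ C δ z.1 = ternQuad A α B γ C δ z.2 ∧ z.1.2 < z.2.2} ≤
      #{z ∈ ternBox L X T ×ˢ ternBox L X T |
      ternQuad A α B γ C δ z.1 = ternQuad A α B γ C δ z.2 ∧ z.2.2 < z.1.2} := by
    refine card_le_card_of_injOn Prod.swap (fun z hz => ?_) Prod.swap_injective.injOn
    rw [mem_coe, mem_filter, mem_product] at hz ⊢
    exact ⟨⟨hz.1.2, hz.1.1⟩, hz.2.1.symm, hz.2.2⟩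
  have heq : #{z ∈ ternBox L X T ×ˢ ternBox L X T |
      ternQuad A α B γ C δ z.1 = ternQuad A α B γ C δ z.2 ∧ z.1.2 = z.2.2} ≤
      T * #{q ∈ pairBox L | quadDiff A α B γ q = 0} := by
    calc _ ≤ #(Ico X (X + T) ×ˢ {q ∈ pairBox L | quadDiff A α B γ q = 0}) := by
          refine card_le_card_of_injOn (fun z => (z.1.2, (z.1.1, z.2.1))) ?_ ?_
          · rintro ⟨⟨p, x⟩, p', x'⟩ hz
            rw [mem_coe, mem_filter, mem_product, mem_ternBox, mem_ternBox] at hz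
            obtain ⟨⟨⟨hp, h1, h2⟩, hp', h3, h4⟩, h5, h6⟩ := hz
            dsimp only at hp hp' h1 h2 h6
            have h8 := quadDiff_of_ternQuad_eq h5
            subst h6
            rw [mem_coe, mem_product, mem_filter, mem_pairBox, mem_Ico]
            refine ⟨⟨h1, h2⟩, ⟨hp, hp'⟩, ?_⟩
            dsimp only at h8 ⊢
            rw [h8, sub_self, zero_mul]
          · rintro ⟨⟨p, x⟩, p', x'⟩ hz ⟨⟨r, y⟩, r', y'⟩ hz' hzz
            rw [mem_coe, mem_filter] at hz hz'
            have h6 := hz.2.2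
            have h6' := hz'.2.2
            simp only [Prod.mk.injEq] at hzz h6 h6' ⊢
            obtain ⟨rfl, rfl, rfl⟩ := hzz
            simp [← h6, ← h6']
      _ = _ := by rw [card_product, Nat.card_Ico, Nat.add_sub_cancel_left]
  have hsub : {z ∈ ternBox L X T ×ˢ ternBox L X T |
      ternQuad A α B γ C δ z.1 = ternQuad A α B γ C δ z.2} ⊆
      {z ∈ ternBox L X T ×ˢ ternBox L X T |
        ternQuad A α B γ C δ z.1 = ternQuad A α B γ C δ z.2 ∧ z.1.2 = z.2.2} ∪
      ({z ∈ ternBox L X T ×ˢ ternBox L X T |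
        ternQuad A α B γ C δ z.1 = ternQuad A α B γ C δ z.2 ∧ z.1.2 < z.2.2} ∪
      {z ∈ ternBox L X T ×ˢ ternBox L X T |
        ternQuad A α B γ C δ z.1 = ternQuad A α B γ C δ z.2 ∧ z.2.2 < z.1.2}) := by
    intro z hz
    rw [mem_filter] at hz
    rw [mem_union, mem_union, mem_filter, mem_filter, mem_filter]
    rcases lt_trichotomy z.1.2 z.2.2 with h | h | h
    · exact Or.inr (Or.inl ⟨hz.1, hz.2, h⟩)
    · exact Or.inl ⟨hz.1, hz.2, h⟩
    · exact Or.inr (Or.inr ⟨hz.1, hz.2, h⟩)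
  have h1 := (card_le_card hsub).trans (card_union_le _ _)
  have h2 := card_union_le {z ∈ ternBox L X T ×ˢ ternBox L X T |
        ternQuad A α B γ C δ z.1 = ternQuad A α B γ C δ z.2 ∧ z.1.2 < z.2.2}
      {z ∈ ternBox L X T ×ˢ ternBox L X T |
        ternQuad A α B γ C δ z.1 = ternQuad A α B γ C δ z.2 ∧ z.2.2 < z.1.2}
  omega

theorem quadDiff_swap (A α B γ : ℕ) (q : (ℕ × ℕ) × (ℕ × ℕ)) :
    quadDiff A α B γ q.swap = -quadDiff A α B γ q := by
  simp [quadDiff]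

theorem two_mul_card_quadDiff_pos_le (A α B γ L : ℕ) :
    2 * #{q ∈ pairBox L | 0 < quadDiff A α B γ q} ≤ L ^ 4 := by
  have h1 : #{q ∈ pairBox L | 0 < quadDiff A α B γ q} ≤
      #{q ∈ pairBox L | ¬ 0 < quadDiff A α B γ q} := by
    refine card_le_card_of_injOn Prod.swap (fun q hq => ?_) Prod.swap_injective.injOn
    rw [mem_coe, mem_filter, mem_pairBox] at hq ⊢
    refine ⟨⟨hq.1.2, hq.1.1⟩, ?_⟩
    rw [quadDiff_swap]
    linarith [hq.2]
  have h2 := card_filter_add_card_filter_not (s := pairBox L) fun q => 0 < quadDiff A α B γ q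
  rw [card_pairBox] at h2
  omega

theorem card_le_of_sub_lt {s : Finset ℕ} {H : ℕ} (h : ∀ m ∈ s, ∀ n ∈ s, n < m + H) : #s ≤ H := by
  rcases s.eq_empty_or_nonempty with rfl | hs
  · simp
  · calc #s ≤ #(Ico (s.min' hs) (s.min' hs + H)) := card_le_card fun n hn =>
          mem_Ico.2 ⟨min'_le _ _ hn, h _ (min'_mem _ _) n hn⟩
      _ = H := by simp

theorem card_quadDiff_pos_lt_le {A α B γ L H : ℕ} (hB : 0 < B) :
    #{q ∈ pairBox L | 0 < quadDiff A α B γ q ∧ quadDiff A α B γ q < (H : ℤ) ^ 2} ≤ L ^ 3 * H := by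
  rw [card_eq_sum_card_fiberwise (f := fun q => (q.1, q.2.1)) (t := (range L ×ˢ range L) ×ˢ range L)]
  · calc _ ≤ ∑ _r ∈ (range L ×ˢ range L) ×ˢ range L, H := by
          refine sum_le_sum fun r _ => ?_
          rw [← card_image_of_injOn (f := fun q : (ℕ × ℕ) × (ℕ × ℕ) => q.2.2)]
          · refine card_le_of_sub_lt fun m hm n hn => ?_
            rw [mem_image] at hm hn
            obtain ⟨q, hq, rfl⟩ := hm
            obtain ⟨q', hq', rfl⟩ := hn
            rw [mem_filter, mem_filter] at hq hq'
            obtain ⟨⟨-, h1, h2⟩, h3⟩ := hq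
            obtain ⟨⟨-, h1', h2'⟩, h3'⟩ := hq'
            subst h3
            simp only [Prod.mk.injEq] at h3'
            by_contra! hlt
            obtain ⟨j, hj⟩ := Nat.exists_eq_add_of_le hlt
            simp only [quadDiff, binQuad, h3'.1, h3'.2, hj] at h1 h2 h1' h2'
            push_cast at h1 h2 h1' h2'
            have hB' : (1 : ℤ) ≤ B := by exact_mod_cast hB
            have e1 : (0 : ℤ) ≤ (q.2.2 : ℤ) * (H + j) := by positivity
            have e2 : (0 : ℤ) ≤ (H : ℤ) * j := by positivity
            have e3 : (0 : ℤ) ≤ (γ : ℤ) * (H + j) := by positivity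
            have e4 : (0 : ℤ) ≤ (j : ℤ) ^ 2 := by positivity
            have e5 : (H : ℤ) ^ 2 ≤ B * (2 * (q.2.2 * (H + j)) + (H : ℤ) ^ 2 + 2 * (H * j) + j ^ 2) := by
              nlinarith
            nlinarith
          · intro q hq q' hq' h
            rw [mem_coe, mem_filter] at hq hq'
            have := hq.2.trans hq'.2.symm
            rw [Prod.mk.injEq] at this
            exact Prod.ext this.1 (Prod.ext this.2 h)
      _ = L ^ 3 * H := by
          rw [sum_const, card_product, card_product, card_range, smul_eq_mul]; ring
  · intro q hq
    rw [mem_coe, mem_filter, mem_pairBox] at hq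
    simp only [mem_coe, mem_product, mem_range]
    exact ⟨hq.1.1, hq.1.2.1⟩

theorem quadDiff_le {A α B γ L : ℕ} {q : (ℕ × ℕ) × (ℕ × ℕ)} (hq : q ∈ pairBox L) :
    quadDiff A α B γ q ≤ ((A + α + B + γ) * L ^ 2 : ℕ) := by
  rw [mem_pairBox] at hq
  obtain ⟨-, h1, h2⟩ := hq
  have e : ∀ {s : ℕ}, s < L → s ^ 2 ≤ L ^ 2 ∧ s ≤ L ^ 2 := fun hs =>
    ⟨Nat.pow_le_pow_left hs.le 2, hs.le.trans (Nat.le_self_pow two_ne_zero L)⟩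
  calc quadDiff A α B γ q ≤ binQuad (A : ℤ) α B γ ((q.2.1 : ℤ), (q.2.2 : ℤ)) := by
        rw [quadDiff, sub_le_self_iff, binQuad]
        positivity
    _ = ((A * q.2.1 ^ 2 + α * q.2.1 + (B * q.2.2 ^ 2 + γ * q.2.2) : ℕ) : ℤ) := by
        simp [binQuad]
    _ ≤ _ := by
        have := Nat.mul_le_mul_left A (e h1).1
        have := Nat.mul_le_mul_left α (e h1).2
        have := Nat.mul_le_mul_left B (e h2).1
        have := Nat.mul_le_mul_left γ (e h2).2
        norm_cast
        nlinarith

theorem coprimeDivisorSum_nonneg (M k : ℕ) : 0 ≤ coprimeDivisorSum M k :=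
  sum_nonneg fun _ _ => by positivity

theorem card_shiftPairs_le {A α B γ C δ L L' M X T k : ℕ} (hC : 0 < C) (hk : 0 < k) (hX : 0 < X)
    (hM : ∀ p : ℕ, p.Prime → p ∣ M → p ∣ A ∧ ¬ p ∣ α)
    (hM' : ∀ p : ℕ, p.Prime → ¬ p ∣ M → ¬ p ∣ 2 * A * B * C)
    (hL : L + (A + α + B + γ) * L ^ 2 / X ≤ L') {lo hi : ℤ}
    (hlo : lo ≤ 2 * C * X - 2 * C * L' * (4 * A + 2 * α + 4 * B + 2 * γ))
    (hhi : 2 * C * (X + T) + δ + 2 * C * L' * (4 * A + 2 * α + 4 * B + 2 * γ) ≤ hi) :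
    (#(shiftPairs A α B γ C δ L X T k) : ℝ) ≤
      #{q ∈ pairBox L' | k * lo ≤ quadDiff A α B γ q ∧ quadDiff A α B γ q ≤ k * hi} *
        (coprimeDivisorSum M k / (2 * C * k)) := by
  have hnn : (0 : ℝ) ≤ coprimeDivisorSum M k / (2 * C * k) :=
    div_nonneg (coprimeDivisorSum_nonneg M k) (by positivity)
  rcases (shiftPairs A α B γ C δ L X T k).eq_empty_or_nonempty with h0 | ⟨q, hq⟩
  · rw [h0, card_empty, Nat.cast_zero]
    positivity
  · have hkL : L + 2 * C * k ≤ L' := by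
      refine le_trans (Nat.add_le_add_left ?_ L) hL
      rw [shiftPairs, mem_filter] at hq
      rw [Nat.le_div_iff_mul_le hX]
      have := hq.2.2.1.trans (quadDiff_le hq.1)
      norm_cast at this
      linarith
    refine (card_filter_le_coprimeDivisorSum hC hk hM hM' hkL _ _ _).trans ?_
    refine mul_le_mul_of_nonneg_right ?_ hnn
    refine Nat.cast_le.2 (card_le_card fun q hq => ?_)
    rw [mem_filter] at hq ⊢
    have hk' : (0 : ℤ) ≤ k := by positivity
    refine ⟨hq.1, le_trans (mul_le_mul_of_nonneg_left ?_ hk') hq.2.1,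
      hq.2.2.trans (mul_le_mul_of_nonneg_left ?_ hk')⟩
    · push_cast; linarith
    · push_cast; linarith

theorem sum_card_shiftPairs_le {A α B γ C δ L L' M X T H w : ℕ} (hB : 0 < B) (hC : 0 < C)
    (hX : 0 < X) (hw : 0 < w) (hH : 0 < H)
    (hM : ∀ p : ℕ, p.Prime → p ∣ M → p ∣ A ∧ ¬ p ∣ α)
    (hM' : ∀ p : ℕ, p.Prime → ¬ p ∣ M → ¬ p ∣ 2 * A * B * C)
    (hMw : ∀ p : ℕ, p.Prime → p ≤ w → p ∣ M)
    (hL : L + (A + α + B + γ) * L ^ 2 / X ≤ L') {lo hi : ℤ} (hlo0 : 0 < lo) (hlohi : lo ≤ hi)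
    (hhi2 : hi ≤ 2 * lo)
    (hlo : lo ≤ 2 * C * X - 2 * C * L' * (4 * A + 2 * α + 4 * B + 2 * γ))
    (hhi : 2 * C * (X + T) + δ + 2 * C * L' * (4 * A + 2 * α + 4 * B + 2 * γ) ≤ hi) :
    2 * C * (2 * ∑ k ∈ Ico 1 T, (#(shiftPairs A α B γ C δ L X T k) : ℝ)) ≤
      (L' : ℝ) ^ 4 * (((hi : ℝ) / lo - 1) * (1 + 1 / (w : ℝ)) + 4 * (Real.sqrt lo / H)) +
        4 * (L' : ℝ) ^ 3 * H := by
  have hlo0' : (0 : ℝ) < lo := by exact_mod_cast hlo0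
  have hlohi' : (lo : ℝ) ≤ hi := by exact_mod_cast hlohi
  have hhi2' : (hi : ℝ) ≤ 2 * lo := by exact_mod_cast hhi2
  have hC' : (0 : ℝ) < C := by exact_mod_cast hC
  have hH' : (0 : ℝ) < H := by exact_mod_cast hH
  set θ := ((hi : ℝ) / lo - 1) * (1 + 1 / (w : ℝ)) with hθdef
  have hθ : 0 ≤ θ := by
    have : (0 : ℝ) ≤ (hi : ℝ) / lo - 1 := by rw [sub_nonneg, one_le_div hlo0']; exact hlohi'
    positivity
  have key : ∀ q : (ℕ × ℕ) × (ℕ × ℕ),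
      ∑ k ∈ Ico 1 T with ((k : ℕ) : ℤ) * lo ≤ quadDiff A α B γ q ∧ quadDiff A α B γ q ≤ k * hi,
        coprimeDivisorSum M k / k ≤
      (if 0 < quadDiff A α B γ q then θ + 4 * (Real.sqrt lo / H) else 0) +
      (if 0 < quadDiff A α B γ q ∧ quadDiff A α B γ q < (H : ℤ) ^ 2 then 2 else 0) := by
    intro q
    have hR : (0 : ℝ) ≤ θ + 4 * (Real.sqrt lo / H) := by positivity
    have hR' : (0 : ℝ) ≤
      (if 0 < quadDiff A α B γ q ∧ quadDiff A α B γ q < (H : ℤ) ^ 2 then 2 else 0) := by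
        split_ifs <;> norm_num
    rcases lt_or_ge (quadDiff A α B γ q) lo with hq | hq
    · rw [filter_false_of_mem, sum_empty]
      · split_ifs <;> linarith
      · rintro k hk ⟨h1, -⟩
        have : (1 : ℤ) ≤ k := by exact_mod_cast (mem_Ico.1 hk).1
        nlinarith
    · have hq' : (lo : ℝ) ≤ (quadDiff A α B γ q : ℝ) := by exact_mod_cast hq
      have hpos : 0 < quadDiff A α B γ q := hlo0.trans_le hq
      have h1 := sum_coprimeDivisorSum_div_le (T := T) hw hMw hlo0' hlohi' hq'
      have h2 : {k ∈ Ico 1 T | ((k : ℕ) : ℤ) * lo ≤ quadDiff A α B γ q ∧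
          quadDiff A α B γ q ≤ k * hi} = {k ∈ (Ico 1 T : Finset ℕ) |
          ((k : ℕ) : ℝ) * lo ≤ (quadDiff A α B γ q : ℝ) ∧ (quadDiff A α B γ q : ℝ) ≤ k * hi} := by
        refine filter_congr fun k _ => ?_
        norm_cast
      rw [h2, if_pos hpos]
      refine h1.trans ?_
      rw [← hθdef, add_assoc]
      refine add_le_add le_rfl ?_
      split_ifs with h3
      · have := one_add_log_mul_le hlo0' hlohi' hhi2' hq'
        have : (0 : ℝ) ≤ 4 * (Real.sqrt lo / H) := by positivity
        linarith
      · rw [add_zero]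
        refine (one_add_log_mul_le_sqrt hlo0' hlohi' hhi2' hq').trans ?_
        have h4 : (H : ℝ) ^ 2 ≤ (quadDiff A α B γ q : ℝ) := by
          push Not at h3
          exact_mod_cast h3 hpos
        have h5 : Real.sqrt lo / H = Real.sqrt (lo / (H : ℝ) ^ 2) := by
          rw [Real.sqrt_div hlo0'.le, Real.sqrt_sq hH'.le]
        rw [h5]
        gcongr
  calc _ ≤ 2 * C * (2 * ∑ k ∈ Ico 1 T,
        (#{q ∈ pairBox L' | k * lo ≤ quadDiff A α B γ q ∧ quadDiff A α B γ q ≤ k * hi} : ℝ) *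
        (coprimeDivisorSum M k / (2 * C * k))) := by
        gcongr with k hk
        exact card_shiftPairs_le hC (mem_Ico.1 hk).1 hX hM hM' hL hlo hhi
    _ = 2 * ∑ k ∈ Ico 1 T, ∑ q ∈ pairBox L',
          if k * lo ≤ quadDiff A α B γ q ∧ quadDiff A α B γ q ≤ k * hi then
            coprimeDivisorSum M k / k else 0 := by
        rw [mul_left_comm, mul_sum]
        congr 1
        refine sum_congr rfl fun k hk => ?_
        have hk0 : (0 : ℝ) < k := by exact_mod_cast (mem_Ico.1 hk).1
        rw [← sum_filter, sum_const, nsmul_eq_mul]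
        field_simp
    _ ≤ 2 * ∑ q ∈ pairBox L', ((if 0 < quadDiff A α B γ q then θ + 4 * (Real.sqrt lo / H) else 0) +
      (if 0 < quadDiff A α B γ q ∧ quadDiff A α B γ q < (H : ℤ) ^ 2 then 2 else 0)) := by
        rw [sum_comm]
        gcongr with q hq
        rw [← sum_filter]
        exact key q
    _ = (2 * #{q ∈ pairBox L' | 0 < quadDiff A α B γ q} : ℕ) * (θ + 4 * (Real.sqrt lo / H)) +
        4 * (#{q ∈ pairBox L' | 0 < quadDiff A α B γ q ∧ quadDiff A α B γ q < (H : ℤ) ^ 2} : ℕ) := by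
        rw [sum_add_distrib, ← sum_filter, ← sum_filter, sum_const, sum_const, nsmul_eq_mul,
          nsmul_eq_mul]
        push_cast
        ring
    _ ≤ (L' ^ 4 : ℕ) * (θ + 4 * (Real.sqrt lo / H)) + 4 * (L' ^ 3 * H : ℕ) := by
        gcongr
        · exact two_mul_card_quadDiff_pos_le A α B γ L'
        · exact card_quadDiff_pos_lt_le hB
    _ = _ := by push_cast; ring

theorem card_dvd_linear_le {A c d e L : ℕ} (hA : 0 < A) (hd : 0 < d) :
    (#{s ∈ range L | d ∣ e * (A * s + c)} : ℝ) ≤ A * L * (Nat.gcd d e / d) + 1 := by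
  have hg : 0 < Nat.gcd d e := Nat.gcd_pos_of_pos_left e hd
  obtain ⟨g, d', e', hg', hcop, hd', he'⟩ := Nat.exists_coprime' hg
  have hgg : Nat.gcd d e = g := by
    rw [hd', he', Nat.gcd_mul_right, hcop.gcd_eq_one, one_mul]
  have hd0 : 0 < d' := Nat.pos_of_ne_zero fun h => by rw [h, zero_mul] at hd'; omega
  have hd0' : (0 : ℝ) < d' := by exact_mod_cast hd0
  have hg0 : (0 : ℝ) < g := by exact_mod_cast hg'
  rw [← card_image_of_injective (f := fun s => A * s + c) _
    fun s t (h : A * s + c = A * t + c) => Nat.eq_of_mul_eq_mul_left hA (Nat.add_right_cancel h)]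
  refine (card_multiples_le (a := c) (b := A * L + c) hd0 (by positivity) ?_ fun k hk => ?_).trans ?_
  · linarith [show (0 : ℝ) ≤ A * L by positivity]
  · rw [mem_image] at hk
    obtain ⟨s, hs, rfl⟩ := hk
    rw [mem_filter, mem_range] at hs
    refine ⟨?_, ?_, ?_⟩
    · have h1 := hs.2
      rw [hd', he', mul_right_comm, Nat.mul_dvd_mul_iff_right hg'] at h1
      exact hcop.dvd_of_dvd_mul_left h1
    · push_cast
      linarith [show (0 : ℝ) ≤ A * s by positivity]
    · have := Nat.mul_le_mul_left A hs.1.le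
      exact_mod_cast Nat.add_le_add_right this c
  · rw [hgg, hd']
    push_cast
    refine le_of_eq ?_
    field_simp
    ring

theorem sum_inv_multiples_le_mul_sum_inv {g : ℕ} (hg : 0 < g) (L : ℕ) :
    ∑ d ∈ Ico 1 L with g ∣ d, (1 / (d : ℝ) : ℝ) ≤ 1 / (g : ℝ) * ∑ j ∈ Ico 1 L, (1 / (j : ℝ) : ℝ) := by
  have hinj : Set.InjOn (fun j => g * j) (Ico 1 L : Finset ℕ) := fun i _ j _ h =>
    Nat.eq_of_mul_eq_mul_left hg h
  calc _ ≤ ∑ d ∈ (Ico 1 L).image fun j => g * j, (1 / (d : ℝ) : ℝ) := by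
        refine sum_le_sum_of_subset_of_nonneg (fun d hd => ?_) fun _ _ _ => by positivity
        rw [mem_filter, mem_Ico] at hd
        obtain ⟨⟨h1, h2⟩, j, rfl⟩ := hd
        refine mem_image_of_mem _ (mem_Ico.2 ⟨Nat.pos_of_mul_pos_left h1, ?_⟩)
        exact (Nat.le_mul_of_pos_left j hg).trans_lt h2
    _ = _ := by
        rw [sum_image hinj, mul_sum]
        refine sum_congr rfl fun j _ => ?_
        rw [Nat.cast_mul, one_div_mul_one_div]

theorem sum_gcd_div_le (L : ℕ) :
    ∑ r ∈ Ico 1 L ×ˢ Ico 1 L, ((Nat.gcd r.1 r.2 : ℕ) / (r.1 : ℝ) : ℝ) ≤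
      L * (∑ j ∈ Ico 1 L, (1 / (j : ℝ) : ℝ)) ^ 2 := by
  have hcard : ∀ g ∈ Ico 1 L, (#{e ∈ Ico 1 L | g ∣ e} : ℝ) * g ≤ L := fun g hg => by
    have h1 : #{e ∈ Ico 1 L | g ∣ e} ≤ L / g := by
      rw [← Nat.card_multiples]
      refine (card_le_card_of_injOn (fun e => e - 1) (fun e he => ?_) fun e he f hf hef => ?_)
      · rw [mem_coe, mem_filter, mem_Ico] at he
        simp only [mem_coe, mem_filter, mem_range]
        rw [Nat.sub_add_cancel he.1.1]
        exact ⟨by omega, he.2⟩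
      · rw [mem_coe, mem_filter, mem_Ico] at he hf
        simp only at hef
        omega
    have h2 : L / g * g ≤ L := Nat.div_mul_le_self L g
    exact_mod_cast (Nat.mul_le_mul_right g h1).trans h2
  calc _ ≤ ∑ r ∈ Ico 1 L ×ˢ Ico 1 L, ∑ g ∈ Ico 1 L,
        (if g ∣ r.1 ∧ g ∣ r.2 then (g : ℝ) / r.1 else 0) := by
        refine sum_le_sum fun r hr => ?_
        rw [mem_product, mem_Ico, mem_Ico] at hr
        have h1 : Nat.gcd r.1 r.2 ∈ Ico 1 L := mem_Ico.2
          ⟨Nat.gcd_pos_of_pos_left _ hr.1.1, (Nat.gcd_le_left _ hr.1.1).trans_lt hr.1.2⟩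
        refine le_trans (le_of_eq ?_) (single_le_sum (fun g _ => ?_) h1)
        · rw [if_pos ⟨Nat.gcd_dvd_left _ _, Nat.gcd_dvd_right _ _⟩]
        · split_ifs <;> positivity
    _ = ∑ g ∈ Ico 1 L, (#{e ∈ Ico 1 L | g ∣ e} : ℝ) * g * ∑ d ∈ Ico 1 L with g ∣ d, (1 / (d : ℝ)) := by
        rw [sum_comm]
        refine sum_congr rfl fun g _ => ?_
        rw [sum_product, sum_filter, mul_sum]
        refine sum_congr rfl fun d _ => ?_
        by_cases h : g ∣ d
        · simp only [h, true_and, if_true]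
          rw [← sum_filter, sum_const, nsmul_eq_mul]
          ring
        · simp [h]
    _ ≤ ∑ g ∈ Ico 1 L, (L : ℝ) * (1 / (g : ℝ) * ∑ j ∈ Ico 1 L, (1 / (j : ℝ))) := by
        refine sum_le_sum fun g hg => ?_
        exact mul_le_mul (hcard g hg)
          (sum_inv_multiples_le_mul_sum_inv (mem_Ico.1 hg).1 L)
          (sum_nonneg fun _ _ => by positivity) (by positivity)
    _ = _ := by
        rw [← mul_sum, ← sum_mul, sq]

theorem card_quadDiff_eq_zero_lt_le {A α B γ L : ℕ} (hA : 0 < A) (hB : 0 < B) :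
    (#{q ∈ pairBox L | quadDiff A α B γ q = 0 ∧ q.1.1 < q.2.1} : ℝ) ≤
      L ^ 2 + 2 * A * L ^ 2 * (∑ j ∈ Ico 1 L, (1 / (j : ℝ) : ℝ)) ^ 2 := by
  have hkey : ∀ q ∈ pairBox L, quadDiff A α B γ q = 0 → q.1.1 < q.2.1 → q.2.2 < q.1.2 ∧
      (q.2.1 - q.1.1) * (2 * A * q.1.1 + (A * (q.2.1 - q.1.1) + α)) =
        (q.1.2 - q.2.2) * (B * (q.1.2 - q.2.2) + 2 * B * q.2.2 + γ) := by
    intro q _ h0 h1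
    obtain ⟨e, he⟩ := Nat.exists_eq_add_of_lt h1
    simp only [quadDiff, binQuad] at h0
    have h2 : q.2.2 < q.1.2 := by
      by_contra! h2
      obtain ⟨d, hd⟩ := Nat.exists_eq_add_of_le h2
      rw [he, hd] at h0
      push_cast at h0
      have hA' : (1 : ℤ) ≤ A := by exact_mod_cast hA
      have e1 : (0 : ℤ) ≤ B * d ^ 2 + 2 * B * q.1.2 * d + γ * d := by positivity
      have e2 : (0 : ℤ) ≤ A * (2 * q.1.1 * (e + 1)) + α * (e + 1) := by positivity
      have e3 : (0 : ℤ) < A * (e + 1) ^ 2 := by positivity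
      nlinarith
    refine ⟨h2, ?_⟩
    obtain ⟨d, hd⟩ := Nat.exists_eq_add_of_lt h2
    rw [he, hd] at h0 ⊢
    have e1 : q.1.1 + e + 1 - q.1.1 = e + 1 := by omega
    have e2 : q.2.2 + d + 1 - q.2.2 = d + 1 := by omega
    rw [e1, e2]
    zify
    push_cast at h0
    linear_combination h0
  calc _ ≤ ((∑ r ∈ Ico 1 L ×ˢ Ico 1 L,
        #{s ∈ range L | r.1 ∣ r.2 * (2 * A * s + (A * r.2 + α))} : ℕ) : ℝ) := by
        rw [card_eq_sum_card_fiberwise (f := fun q => (q.1.2 - q.2.2, q.2.1 - q.1.1))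
          (t := Ico 1 L ×ˢ Ico 1 L)]
        · refine Nat.cast_le.2 (sum_le_sum fun r hr => ?_)
          refine card_le_card_of_injOn (fun q => q.1.1) (fun q hq => ?_) fun q hq q' hq' hqq => ?_
          · rw [mem_coe, mem_filter, mem_filter] at hq
            obtain ⟨⟨h1, h2, h3⟩, rfl⟩ := hq
            simp only [mem_coe, mem_filter, mem_range]
            exact ⟨(mem_pairBox.1 h1).1.1, (hkey q h1 h2 h3).2 ▸ Nat.dvd_mul_right _ _⟩
          · rw [mem_coe, mem_filter, mem_filter] at hq hq'
            obtain ⟨⟨h1, h2, h3⟩, rfl⟩ := hq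
            obtain ⟨⟨h1', h2', h3'⟩, h4⟩ := hq'
            rw [Prod.mk.injEq] at h4
            obtain ⟨h5, h6⟩ := hkey q h1 h2 h3
            obtain ⟨h5', h6'⟩ := hkey q' h1' h2' h3'
            simp only at hqq
            rw [h4.1, h4.2, ← hqq, h6] at h6'
            have h7 := Nat.eq_of_mul_eq_mul_left (by omega) h6'
            have h8 : q.2.2 = q'.2.2 :=
              Nat.eq_of_mul_eq_mul_left (show 0 < 2 * B by omega) (by omega)
            refine Prod.ext (Prod.ext hqq ?_) (Prod.ext ?_ h8) <;> omega
        · intro q hq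
          rw [mem_coe, mem_filter] at hq
          have h1 := (hkey q hq.1 hq.2.1 hq.2.2).1
          have h2 := mem_pairBox.1 hq.1
          simp only [mem_coe, mem_product, mem_Ico]
          omega
    _ ≤ ∑ r ∈ Ico 1 L ×ˢ Ico 1 L, (2 * A * L * ((Nat.gcd r.1 r.2 : ℕ) / (r.1 : ℝ)) + 1) := by
        push_cast
        refine sum_le_sum fun r hr => ?_
        have := card_dvd_linear_le (A := 2 * A) (c := A * r.2 + α) (d := r.1) (e := r.2) (L := L)
          (by omega) (mem_Ico.1 (mem_product.1 hr).1).1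
        push_cast at this
        exact this
    _ ≤ 2 * A * L * (L * (∑ j ∈ Ico 1 L, (1 / (j : ℝ) : ℝ)) ^ 2) + L ^ 2 := by
        rw [sum_add_distrib, ← mul_sum]
        refine add_le_add (mul_le_mul_of_nonneg_left (sum_gcd_div_le L) (by positivity)) ?_
        rw [sum_const, card_product, Nat.card_Ico, nsmul_eq_mul, mul_one, sq]
        have : L - 1 ≤ L := Nat.sub_le _ _
        exact_mod_cast Nat.mul_le_mul this this
    _ = _ := by ring

theorem card_quadDiff_eq_zero_le {A α B γ L : ℕ} (hA : 0 < A) (hB : 0 < B) :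
    (#{q ∈ pairBox L | quadDiff A α B γ q = 0} : ℝ) ≤
      3 * L ^ 2 + 4 * A * L ^ 2 * (∑ j ∈ Ico 1 L, (1 / (j : ℝ) : ℝ)) ^ 2 := by
  have hlt := card_quadDiff_eq_zero_lt_le (α := α) (γ := γ) (L := L) hA hB
  have hgt : #{q ∈ pairBox L | quadDiff A α B γ q = 0 ∧ q.2.1 < q.1.1} ≤
      #{q ∈ pairBox L | quadDiff A α B γ q = 0 ∧ q.1.1 < q.2.1} := by
    refine card_le_card_of_injOn Prod.swap (fun q hq => ?_) Prod.swap_injective.injOn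
    rw [mem_coe, mem_filter, mem_pairBox] at hq ⊢
    exact ⟨⟨hq.1.2, hq.1.1⟩, by rw [quadDiff_swap, hq.2.1, neg_zero], hq.2.2⟩
  have heq : #{q ∈ pairBox L | quadDiff A α B γ q = 0 ∧ q.1.1 = q.2.1} ≤ L ^ 2 := by
    calc _ ≤ #(range L ×ˢ range L) := by
          have hv : ∀ q : (ℕ × ℕ) × (ℕ × ℕ), quadDiff A α B γ q = 0 → q.1.1 = q.2.1 →
              q.2.2 = q.1.2 := by
            intro q h1 h2
            simp only [quadDiff, binQuad, h2] at h1
            have h3 : ((q.2.2 : ℤ) - q.1.2) * (B * (q.2.2 + q.1.2) + γ) = 0 := by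
              linear_combination h1
            rcases mul_eq_zero.1 h3 with h | h
            · exact_mod_cast sub_eq_zero.1 h
            · have hB' : (1 : ℤ) ≤ B := by exact_mod_cast hB
              have : (q.2.2 : ℤ) + q.1.2 ≤ B * (q.2.2 + q.1.2) :=
                le_mul_of_one_le_left (by positivity) hB'
              omega
          refine card_le_card_of_injOn (fun q => q.1) (fun q hq => ?_) fun q hq q' hq' h => ?_
          · rw [mem_coe, mem_filter, mem_pairBox] at hq
            simp only [mem_coe, mem_product, mem_range]
            exact hq.1.1
          · rw [mem_coe, mem_filter] at hq hq'
            have e1 := hv q hq.2.1 hq.2.2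
            have e2 := hv q' hq'.2.1 hq'.2.2
            simp only at h
            refine Prod.ext h (Prod.ext ?_ ?_)
            · rw [← hq.2.2, ← hq'.2.2, h]
            · rw [e1, e2, h]
      _ = L ^ 2 := by rw [card_product, card_range, sq]
  have hsub : {q ∈ pairBox L | quadDiff A α B γ q = 0} ⊆
      {q ∈ pairBox L | quadDiff A α B γ q = 0 ∧ q.1.1 = q.2.1} ∪
      ({q ∈ pairBox L | quadDiff A α B γ q = 0 ∧ q.1.1 < q.2.1} ∪
       {q ∈ pairBox L | quadDiff A α B γ q = 0 ∧ q.2.1 < q.1.1}) := by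
    intro q hq
    rw [mem_filter] at hq
    rw [mem_union, mem_union, mem_filter, mem_filter, mem_filter]
    rcases lt_trichotomy q.1.1 q.2.1 with h | h | h
    · exact Or.inr (Or.inl ⟨hq.1, hq.2, h⟩)
    · exact Or.inl ⟨hq.1, hq.2, h⟩
    · exact Or.inr (Or.inr ⟨hq.1, hq.2, h⟩)
  have h1 := (card_le_card hsub).trans ((card_union_le _ _).trans
    (Nat.add_le_add_left (card_union_le _ _) _))
  have h2 : #{q ∈ pairBox L | quadDiff A α B γ q = 0} ≤
      L ^ 2 + 2 * #{q ∈ pairBox L | quadDiff A α B γ q = 0 ∧ q.1.1 < q.2.1} := by omega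
  have h3 : (#{q ∈ pairBox L | quadDiff A α B γ q = 0} : ℝ) ≤
      (L : ℝ) ^ 2 + 2 * #{q ∈ pairBox L | quadDiff A α B γ q = 0 ∧ q.1.1 < q.2.1} := by
    exact_mod_cast h2
  linarith

theorem sum_inv_Ico_pow_le {t : ℕ} (ht : 0 < t) :
    ∑ j ∈ Ico 1 (t ^ 10), (1 / (j : ℝ) : ℝ) ≤ 10 * t := by
  have h1 := harmonic_le_one_add_log (t ^ 10)
  rw [harmonic_eq_sum_Icc] at h1
  push_cast at h1
  have h2 : Real.log t ≤ t - 1 := Real.log_le_sub_one_of_pos (by exact_mod_cast ht)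
  have h3 : ∑ j ∈ Ico 1 (t ^ 10), (1 / (j : ℝ) : ℝ) ≤ ∑ i ∈ Icc 1 (t ^ 10), ((i : ℝ))⁻¹ := by
    simp only [one_div]
    exact sum_le_sum_of_subset_of_nonneg Ico_subset_Icc_self fun _ _ _ => by positivity
  rw [Real.log_pow] at h1
  push_cast at h1
  linarith

/-- The polynomial `((1 + u) ^ 12 - 1) / u`. -/
def stepPoly (u : ℝ) : ℝ := ∑ i ∈ range 12, (Nat.choose 12 (i + 1) : ℝ) * u ^ i

theorem mul_stepPoly (u : ℝ) : u * stepPoly u = (1 + u) ^ 12 - 1 := by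
  simp only [stepPoly, sum_range_succ, range_zero, sum_empty, Nat.choose]
  push_cast
  ring

theorem stepPoly_zero : stepPoly 0 = 12 := by
  simp [stepPoly, sum_range_succ]

theorem continuous_stepPoly : Continuous stepPoly := by
  unfold stepPoly
  fun_prop

/-- The normalised upper bound for the number of coincidences of `ternQuad`. -/
noncomputable def energyBound (A C δ D₁ D r u : ℝ) : ℝ :=
  2 * C * stepPoly u * (3 * u ^ 8 + 400 * A * u ^ 6) +
    ((1 + D₁ * u ^ 2) ^ 4 *
      ((2 * C * stepPoly u + δ * u ^ 11 + 4 * C * D * (1 + D₁ * u ^ 2) * u) /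
        (2 * C - 2 * C * D * (1 + D₁ * u ^ 2) * u ^ 2) * r +
        4 * (Real.sqrt (2 * C - 2 * C * D * (1 + D₁ * u ^ 2) * u ^ 2) * u)) +
      4 * (1 + D₁ * u ^ 2) ^ 3 * u)

theorem energyBound_zero {C : ℝ} (hC : 0 < C) (A δ D₁ D r : ℝ) :
    energyBound A C δ D₁ D r 0 = 12 * r := by
  simp only [energyBound, stepPoly_zero]
  field_simp
  ring

theorem continuousAt_energyBound {C : ℝ} (hC : 0 < C) (A δ D₁ D r : ℝ) :
    ContinuousAt (energyBound A C δ D₁ D r) 0 := by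
  have := continuous_stepPoly
  unfold energyBound
  have h : 2 * C - 2 * C * D * (1 + D₁ * (0 : ℝ) ^ 2) * 0 ^ 2 ≠ 0 := by
    simp; exact hC.ne'
  have h1 : ContinuousAt (fun u : ℝ =>
      (2 * C * stepPoly u + δ * u ^ 11 + 4 * C * D * (1 + D₁ * u ^ 2) * u) /
        (2 * C - 2 * C * D * (1 + D₁ * u ^ 2) * u ^ 2)) 0 := by
    refine ContinuousAt.div (Continuous.continuousAt (by fun_prop))
      (Continuous.continuousAt (by fun_prop)) h
  have h2 : Continuous fun u : ℝ =>
    4 * (Real.sqrt (2 * C - 2 * C * D * (1 + D₁ * u ^ 2) * u ^ 2) * u) := by fun_prop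
  exact (Continuous.continuousAt (by fun_prop)).add
    (((Continuous.continuousAt (by fun_prop)).mul ((h1.mul continuousAt_const).add
      h2.continuousAt)).add (Continuous.continuousAt (by fun_prop)))

theorem card_ternQuad_eq_le_energyBound {A α B γ C δ M w : ℕ} (hA : 0 < A) (hB : 0 < B)
    (hC : 0 < C) (hw : 0 < w)
    (hM : ∀ p : ℕ, p.Prime → p ∣ M → p ∣ A ∧ ¬ p ∣ α)
    (hM' : ∀ p : ℕ, p.Prime → ¬ p ∣ M → ¬ p ∣ 2 * A * B * C)
    (hMw : ∀ p : ℕ, p.Prime → p ≤ w → p ∣ M) {D₁ D : ℕ} (hD₁ : D₁ = A + α + B + γ)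
    (hD : D = 4 * A + 2 * α + 4 * B + 2 * γ) {t L X T : ℕ} (ht : 0 < t)
    (hL : L = t ^ 10) (hX : X = t ^ 12) (hT : X + T = (t + 1) ^ 12)
    (hlo0 : 2 * C * D * (t ^ 10 + D₁ * t ^ 8) < 2 * C * t ^ 12)
    (hlohi : 2 * C * (t + 1) ^ 12 + δ + 6 * C * D * (t ^ 10 + D₁ * t ^ 8) ≤ 4 * C * t ^ 12) :
    2 * (C : ℝ) * #{z ∈ ternBox L X T ×ˢ ternBox L X T |
      ternQuad A α B γ C δ z.1 = ternQuad A α B γ C δ z.2} ≤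
    (t : ℝ) ^ 39 * energyBound A C δ D₁ D (1 + 1 / (w : ℝ)) ((t : ℝ)⁻¹) := by
  have ht' : (0 : ℝ) < t := by exact_mod_cast ht
  set L' := t ^ 10 + D₁ * t ^ 8 with hL'
  have hXp : 0 < X := hX ▸ Nat.pow_pos ht
  have hLL : L + (A + α + B + γ) * L ^ 2 / X ≤ L' := by
    rw [hL', hL, hX, ← hD₁]
    refine Nat.add_le_add_left (le_of_eq ?_) _
    refine Nat.div_eq_of_eq_mul_left (Nat.pow_pos ht) ?_
    ring
  set lo : ℤ := 2 * C * t ^ 12 - 2 * C * D * L' with hlo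
  set hi : ℤ := 2 * C * (t + 1) ^ 12 + δ + 2 * C * D * L' with hhi
  have e1 : 0 < lo := by rw [hlo, sub_pos]; exact_mod_cast hlo0
  have e2 : hi ≤ 2 * lo := by
    have : (2 * C * (t + 1) ^ 12 + δ + 6 * C * D * L' : ℤ) ≤ 4 * C * t ^ 12 := by
      exact_mod_cast hlohi
    rw [hhi, hlo]; linarith
  have e3 : lo ≤ hi := by
    have h1 : (2 * C * t ^ 12 : ℤ) ≤ 2 * C * (t + 1) ^ 12 := by
      have : (t : ℤ) ^ 12 ≤ (t + 1) ^ 12 := by gcongr; omega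
      gcongr
    have h2 : (0 : ℤ) ≤ 2 * C * D * L' := by positivity
    rw [hlo, hhi]
    linarith [show (0 : ℤ) ≤ δ by positivity]
  have hTz : (X : ℤ) + T = (t + 1) ^ 12 := by exact_mod_cast hT
  have hS := sum_card_shiftPairs_le (δ := δ) (T := T) (H := t ^ 8) hB hC hXp hw (Nat.pow_pos ht)
    hM hM' hMw hLL e1 e3 e2 (by rw [hlo, hX, hD]; push_cast; exact le_of_eq (by ring))
    (by rw [hTz, hhi, hD]; push_cast; exact le_of_eq (by ring))
  have hDg := card_quadDiff_eq_zero_le (α := α) (γ := γ) (L := L) hA hB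
  have hE := card_ternQuad_eq_le (A := A) (α := α) (B := B) (γ := γ) (δ := δ) (L := L) (X := X)
    (T := T) hC
  have hE' : (#{z ∈ ternBox L X T ×ˢ ternBox L X T |
      ternQuad A α B γ C δ z.1 = ternQuad A α B γ C δ z.2} : ℝ) ≤
      T * #{q ∈ pairBox L | quadDiff A α B γ q = 0} +
      2 * ∑ k ∈ Ico 1 T, (#(shiftPairs A α B γ C δ L X T k) : ℝ) := by exact_mod_cast hE
  have hharm : ∑ j ∈ Ico 1 L, (1 / (j : ℝ) : ℝ) ≤ 10 * t := hL ▸ sum_inv_Ico_pow_le ht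
  have hDg' : (#{q ∈ pairBox L | quadDiff A α B γ q = 0} : ℝ) ≤
      3 * (t : ℝ) ^ 20 + 400 * A * t ^ 22 := by
    refine hDg.trans ?_
    have h0 : (0 : ℝ) ≤ ∑ j ∈ Ico 1 L, (1 / (j : ℝ) : ℝ) := sum_nonneg fun _ _ => by positivity
    calc _ ≤ 3 * (L : ℝ) ^ 2 + 4 * A * (L : ℝ) ^ 2 * (10 * t) ^ 2 := by gcongr
      _ = _ := by rw [hL]; push_cast; ring
  set u : ℝ := (t : ℝ)⁻¹ with hu
  have htu : (t : ℝ) * u = 1 := mul_inv_cancel₀ ht'.ne'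
  have hTr : (T : ℝ) = t ^ 11 * stepPoly u := by
    have h1 : (X : ℝ) + T = (t + 1) ^ 12 := by exact_mod_cast hT
    have h2 : (t : ℝ) ^ 12 * (u * stepPoly u) = t ^ 12 * ((1 + u) ^ 12 - 1) := by
      rw [mul_stepPoly]
    have h3 : (t : ℝ) ^ 12 * (1 + u) ^ 12 = (t + 1) ^ 12 := by
      rw [← mul_pow, mul_add, htu, mul_one]
    rw [hX] at h1
    push_cast at h1
    linear_combination h1 - h2 - h3 + t ^ 11 * stepPoly u * htu
  have hL'r : (L' : ℝ) = t ^ 10 * (1 + D₁ * u ^ 2) := by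
    rw [hL']
    push_cast
    linear_combination (-(D₁ : ℝ) * t ^ 8 * (t * u + 1)) * htu
  have hlor : (lo : ℝ) = t ^ 12 * (2 * C - 2 * C * D * (1 + D₁ * u ^ 2) * u ^ 2) := by
    have : (lo : ℝ) = 2 * C * t ^ 12 - 2 * C * D * L' := by rw [hlo]; push_cast; ring
    rw [this, hL'r]
    linear_combination (2 * C * D * (1 + D₁ * u ^ 2) * t ^ 10 * (t * u + 1)) * htu
  have hhilo : (hi : ℝ) - lo =
      t ^ 11 * (2 * C * stepPoly u + δ * u ^ 11 + 4 * C * D * (1 + D₁ * u ^ 2) * u) := by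
    have h1 : (hi : ℝ) = 2 * C * (t + 1) ^ 12 + δ + 2 * C * D * L' := by
      rw [hhi]; push_cast; ring
    have h2 : (lo : ℝ) = 2 * C * t ^ 12 - 2 * C * D * L' := by rw [hlo]; push_cast; ring
    have h3 : (t : ℝ) ^ 12 + T = (t + 1) ^ 12 := by rw [hX] at hT; exact_mod_cast hT
    have h4 : (t : ℝ) ^ 11 * u ^ 11 = 1 := by rw [← mul_pow, htu, one_pow]
    rw [h1, h2, ← h3, hTr, hL'r]
    linear_combination (-(δ : ℝ)) * h4 -
      (4 * C * D * (1 + D₁ * u ^ 2) * t ^ 10) * htu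
  set Y := 2 * (C : ℝ) - 2 * C * D * (1 + D₁ * u ^ 2) * u ^ 2 with hY
  have hlopos : (0 : ℝ) < lo := by exact_mod_cast e1
  have hYpos : 0 < Y := by
    rw [hlor] at hlopos
    exact pos_of_mul_pos_right hlopos (by positivity)
  have hsqrt : Real.sqrt lo / ((t ^ 8 : ℕ) : ℝ) = Real.sqrt Y * u ^ 2 := by
    have h1 : (t : ℝ) ^ 12 = (t ^ 6) ^ 2 := by ring
    rw [hlor, Real.sqrt_mul (by positivity), h1, Real.sqrt_sq (by positivity), hu]
    push_cast
    field_simp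
  have hθ : (hi : ℝ) / lo - 1 =
      u * ((2 * C * stepPoly u + δ * u ^ 11 + 4 * C * D * (1 + D₁ * u ^ 2) * u) / Y) := by
    rw [div_sub_one hlopos.ne', hhilo, hlor, hu]
    field_simp
  rw [hθ, hsqrt, hL'r] at hS
  calc _ ≤ 2 * (C : ℝ) * (T * (3 * (t : ℝ) ^ 20 + 400 * A * t ^ 22)) +
        2 * C * (2 * ∑ k ∈ Ico 1 T, (#(shiftPairs A α B γ C δ L X T k) : ℝ)) := by
        rw [← mul_add]
        gcongr
        refine hE'.trans ?_
        gcongr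
    _ ≤ 2 * (C : ℝ) * ((t ^ 11 * stepPoly u) * (3 * (t : ℝ) ^ 20 + 400 * A * t ^ 22)) + _ :=
        add_le_add (by rw [hTr]) hS
    _ = _ := by
        rw [energyBound, ← hY]
        push_cast
        have ht1 : (t : ℝ) = u⁻¹ := by rw [hu, inv_inv]
        have hu0 : u ≠ 0 := inv_ne_zero ht'.ne'
        rw [ht1]
        field_simp

theorem card_Ico_filter_not_mem_image_le {A α B γ C δ L X T V : ℕ}
    (hV : δ * (X + T) + (A + α + B + γ) * L ^ 2 ≤ V) {R : ℕ → Prop} [DecidablePred R]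
    (hR : ∀ z, R (ternQuad A α B γ C δ z)) :
    #{n ∈ Ico (C * X ^ 2) (C * (X + T) ^ 2) | ¬ R n} + #((ternBox L X T).image (ternQuad A α B γ C δ))
      ≤ C * T * (2 * X + T) + V + 1 := by
  have hdisj : Disjoint {n ∈ Ico (C * X ^ 2) (C * (X + T) ^ 2) | ¬ R n}
      ((ternBox L X T).image (ternQuad A α B γ C δ)) := by
    rw [disjoint_left]
    intro n hn hn'
    obtain ⟨z, -, rfl⟩ := mem_image.1 hn'
    exact (mem_filter.1 hn).2 (hR z)
  rw [← card_union_of_disjoint hdisj]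
  have hsub : {n ∈ Ico (C * X ^ 2) (C * (X + T) ^ 2) | ¬ R n} ∪
      ((ternBox L X T).image (ternQuad A α B γ C δ)) ⊆
      Icc (C * X ^ 2) (C * (X + T) ^ 2 + V) := by
    refine union_subset (fun n hn => ?_) fun n hn => ?_
    · have := mem_Ico.1 (mem_filter.1 hn).1
      rw [mem_Icc]
      omega
    · obtain ⟨z, hz, rfl⟩ := mem_image.1 hn
      rw [mem_ternBox] at hz
      obtain ⟨⟨h1, h2⟩, h3, h4⟩ := hz
      have e : ∀ {s : ℕ}, s < L → s ^ 2 ≤ L ^ 2 ∧ s ≤ L ^ 2 := fun hs =>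
        ⟨Nat.pow_le_pow_left hs.le 2, hs.le.trans (Nat.le_self_pow two_ne_zero L)⟩
      have := Nat.mul_le_mul_left A (e h1).1
      have := Nat.mul_le_mul_left α (e h1).2
      have := Nat.mul_le_mul_left B (e h2).1
      have := Nat.mul_le_mul_left γ (e h2).2
      have := Nat.mul_le_mul_left δ h4.le
      have := Nat.mul_le_mul_left C (Nat.pow_le_pow_left h3 2)
      have := Nat.mul_le_mul_left C (Nat.pow_le_pow_left h4.le 2)
      rw [mem_Icc, ternQuad]
      constructor
      · omega
      · nlinarith
  refine (card_le_card hsub).trans ?_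
  rw [Nat.card_Icc]
  have : C * (X + T) ^ 2 = C * X ^ 2 + C * T * (2 * X + T) := by ring
  omega

theorem eventually_lt_of_continuousAt {f : ℝ → ℝ} {b : ℝ} (h : f 0 < b) (hf : ContinuousAt f 0) :
    ∀ᶠ u in nhds (0 : ℝ), f u < b :=
  Filter.Tendsto.eventually_lt_const h hf

theorem eventually_inv_cast {P : ℝ → Prop} (h : ∀ᶠ u : ℝ in nhds 0, P u) :
    ∀ᶠ t : ℕ in Filter.atTop, P ((t : ℝ)⁻¹) :=
  (tendsto_inv_atTop_nhds_zero_nat (𝕜 := ℝ)).eventually h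

set_option maxHeartbeats 1000000 in
theorem eventually_card_window_le {A α B γ C δ M w : ℕ} (hA : 0 < A) (hB : 0 < B)
    (hC : 0 < C) (hw : 0 < w)
    (hM : ∀ p : ℕ, p.Prime → p ∣ M → p ∣ A ∧ ¬ p ∣ α)
    (hM' : ∀ p : ℕ, p.Prime → ¬ p ∣ M → ¬ p ∣ 2 * A * B * C)
    (hMw : ∀ p : ℕ, p.Prime → p ≤ w → p ∣ M) {R : ℕ → Prop} [DecidablePred R]
    (hR : ∀ z, R (ternQuad A α B γ C δ z)) :
    ∀ᶠ t : ℕ in Filter.atTop,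
      w * #{n ∈ Ico (C * t ^ 24) (C * (t + 1) ^ 24) | ¬ R n} ≤
        C * (t + 1) ^ 24 - C * t ^ 24 := by
  obtain ⟨D₁, hD₁⟩ : ∃ D₁, D₁ = A + α + B + γ := ⟨_, rfl⟩
  obtain ⟨D, hD⟩ : ∃ D, D = 4 * A + 2 * α + 4 * B + 2 * γ := ⟨_, rfl⟩
  have hC' : (0 : ℝ) < C := by exact_mod_cast hC
  have hw' : (0 : ℝ) < w := by exact_mod_cast hw
  set r : ℝ := 1 + 1 / (w : ℝ) with hr
  set G := energyBound A C δ D₁ D r with hG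
  have hG0 : G 0 = 12 * r := energyBound_zero hC' _ _ _ _ _
  have hGc : ContinuousAt G 0 := continuousAt_energyBound hC' _ _ _ _ _
  have hPc := continuous_stepPoly
  have hr1 : 0 < r := by positivity
  have ev1 : ∀ᶠ u : ℝ in nhds 0, 0 < G u := by
    refine hGc.eventually_const_lt ?_
    rw [hG0]; positivity
  have ev2 : ∀ᶠ u : ℝ in nhds 0,
      2 * C * D * (1 + D₁ * u ^ 2) * u ^ 2 < 2 * C := by
    refine eventually_lt_of_continuousAt ?_ (Continuous.continuousAt (by fun_prop))
    simpa using hC'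
  have ev3 : ∀ᶠ u : ℝ in nhds 0,
      2 * C * (1 + u) ^ 12 + δ * u ^ 12 + 6 * C * D * (1 + D₁ * u ^ 2) * u ^ 2 < 4 * C := by
    refine eventually_lt_of_continuousAt ?_ (Continuous.continuousAt (by fun_prop))
    simp
    linarith
  have ev4 : ∀ᶠ u : ℝ in nhds 0,
      w * (C * stepPoly u * (2 + u * stepPoly u) + (δ * (1 + u) ^ 12 * u ^ 11 + D₁ * u ^ 3 + u ^ 23)
        - 2 * C * stepPoly u ^ 2 / G u) - C * stepPoly u * (2 + u * stepPoly u) < 0 := by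
    refine eventually_lt_of_continuousAt ?_ ?_
    · rw [hG0, stepPoly_zero, hr]
      have : 2 * (C : ℝ) * 12 ^ 2 / (12 * (1 + 1 / w)) = 24 * C * (w / (w + 1)) := by
        field_simp; norm_num
      rw [this]
      have h2 : (w : ℝ) / (w + 1) = 1 - 1 / (w + 1) := by field_simp; ring
      have h3 : (w : ℝ) * (1 / (w + 1)) = 1 - 1 / (w + 1) := by field_simp; ring
      have h4 : 0 < C * (1 / ((w : ℝ) + 1)) := by positivity
      rw [h2]
      linear_combination 24 * C * h3 + 24 * h4
    · refine ContinuousAt.sub (continuousAt_const.mul (ContinuousAt.sub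
        (Continuous.continuousAt (by fun_prop)) ?_)) (Continuous.continuousAt (by fun_prop))
      refine ContinuousAt.div (Continuous.continuousAt (by fun_prop)) hGc ?_
      rw [hG0]; positivity
  filter_upwards [eventually_inv_cast ev1, eventually_inv_cast ev2, eventually_inv_cast ev3,
    eventually_inv_cast ev4, Filter.eventually_gt_atTop 0] with t h1 h2 h3 h4 ht
  have ht' : (0 : ℝ) < t := by exact_mod_cast ht
  set u : ℝ := (t : ℝ)⁻¹ with hu
  have htu : (t : ℝ) * u = 1 := mul_inv_cancel₀ ht'.ne'
  have htn : ∀ n : ℕ, (t : ℝ) ^ n * u ^ n = 1 := fun n => by rw [← mul_pow, htu, one_pow]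
  obtain ⟨T, hT⟩ := Nat.exists_eq_add_of_le (Nat.pow_le_pow_left (Nat.le_succ t) 12)
  have hT' : t ^ 12 + T = (t + 1) ^ 12 := hT.symm
  have hTu : (t : ℝ) ^ 12 * (1 + u) ^ 12 = (t + 1) ^ 12 := by
    rw [← mul_pow, mul_add, htu, mul_one]
  have hTr : (T : ℝ) = t ^ 11 * stepPoly u := by
    have e1 : (t : ℝ) ^ 12 + T = (t + 1) ^ 12 := by exact_mod_cast hT'
    have e2 : (t : ℝ) ^ 12 * (u * stepPoly u) = t ^ 12 * ((1 + u) ^ 12 - 1) := by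
      rw [mul_stepPoly]
    linear_combination e1 - e2 - hTu + t ^ 11 * stepPoly u * htu
  have hlo0 : 2 * C * D * (t ^ 10 + D₁ * t ^ 8) < 2 * C * t ^ 12 := by
    have e := mul_lt_mul_of_pos_left h2 (pow_pos ht' 12)
    have : (2 * C * D * (t ^ 10 + D₁ * t ^ 8) : ℝ) < 2 * C * t ^ 12 := by
      have e1 : (t : ℝ) ^ 12 * (2 * C * D * (1 + D₁ * u ^ 2) * u ^ 2) =
          2 * C * D * (t ^ 10 + D₁ * t ^ 8) := by
        linear_combination (2 * C * D * t ^ 10 : ℝ) * htn 2 + (2 * C * D * D₁ * t ^ 8 : ℝ) * htn 4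
      linarith
    exact_mod_cast this
  have hlohi : 2 * C * (t + 1) ^ 12 + δ + 6 * C * D * (t ^ 10 + D₁ * t ^ 8) ≤ 4 * C * t ^ 12 := by
    have e := mul_lt_mul_of_pos_left h3 (pow_pos ht' 12)
    have : (2 * C * (t + 1) ^ 12 + δ + 6 * C * D * (t ^ 10 + D₁ * t ^ 8) : ℝ) ≤ 4 * C * t ^ 12 := by
      have e1 : (t : ℝ) ^ 12 * (2 * C * (1 + u) ^ 12 + δ * u ^ 12 +
          6 * C * D * (1 + D₁ * u ^ 2) * u ^ 2) =
          2 * C * (t + 1) ^ 12 + δ + 6 * C * D * (t ^ 10 + D₁ * t ^ 8) := by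
        linear_combination 2 * C * hTu + δ * htn 12 + (6 * C * D * t ^ 10 : ℝ) * htn 2 +
          (6 * C * D * D₁ * t ^ 8 : ℝ) * htn 4
      linarith
    exact_mod_cast this
  have hE := card_ternQuad_eq_le_energyBound (δ := δ) hA hB hC hw hM hM' hMw hD₁ hD ht
    (L := t ^ 10) (X := t ^ 12) rfl rfl hT' hlo0 hlohi
  rw [← hr, ← hu, ← hG] at hE
  have hCS := sq_card_le_card_image_mul (ternBox (t ^ 10) (t ^ 12) T) (ternQuad A α B γ C δ)
  rw [card_ternBox] at hCS
  have hcount := card_Ico_filter_not_mem_image_le (A := A) (α := α) (B := B) (γ := γ) (C := C)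
    (δ := δ) (L := t ^ 10) (X := t ^ 12) (T := T) le_rfl hR
  rw [hT', ← hD₁, show (t ^ 12) ^ 2 = t ^ 24 by ring,
    show ((t + 1) ^ 12) ^ 2 = (t + 1) ^ 24 by ring] at hcount
  have hW : C * T * (2 * t ^ 12 + T) = C * (t + 1) ^ 24 - C * t ^ 24 := by
    refine (Nat.sub_eq_of_eq_add ?_).symm
    have : (t + 1) ^ 24 = (t ^ 12 + T) ^ 2 := by rw [hT', ← pow_mul]
    rw [this]; ring
  have hWr : ((C * (t + 1) ^ 24 - C * t ^ 24 : ℕ) : ℝ) =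
      t ^ 23 * (C * stepPoly u * (2 + u * stepPoly u)) := by
    rw [← hW]
    push_cast
    rw [hTr]
    linear_combination (-(C : ℝ) * t ^ 22 * stepPoly u ^ 2) * htu
  set I := #((ternBox (t ^ 10) (t ^ 12) T).image (ternQuad A α B γ C δ)) with hI
  have hIlow : (t : ℝ) ^ 23 * (2 * C * stepPoly u ^ 2 / G u) ≤ I := by
    rw [← mul_div_assoc, div_le_iff₀ h1]
    have e1 : (((t ^ 10) ^ 2 * T : ℕ) : ℝ) ^ 2 ≤ I * #{z ∈ ternBox (t ^ 10) (t ^ 12) T ×ˢ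
        ternBox (t ^ 10) (t ^ 12) T |
        ternQuad A α B γ C δ z.1 = ternQuad A α B γ C δ z.2} := by exact_mod_cast hCS
    push_cast at e1
    rw [hTr] at e1
    have e2 := mul_le_mul_of_nonneg_left hE (Nat.cast_nonneg (α := ℝ) I)
    have e3 : (t : ℝ) ^ 39 * (t ^ 23 * (2 * C * stepPoly u ^ 2)) ≤ t ^ 39 * (I * G u) := by
      have e4 := mul_le_mul_of_nonneg_left e1 (show (0 : ℝ) ≤ 2 * C by positivity)
      linear_combination e2 + e4
    exact le_of_mul_le_mul_left e3 (by positivity)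
  have hcr : (#{n ∈ Ico (C * t ^ 24) (C * (t + 1) ^ 24) | ¬ R n} : ℝ) + I ≤
      t ^ 23 * (C * stepPoly u * (2 + u * stepPoly u)) +
        (δ * (t + 1) ^ 12 + D₁ * (t ^ 10) ^ 2) + 1 := by
    rw [← hWr, ← hW]
    exact_mod_cast hcount
  have hov : (δ * (t + 1) ^ 12 + D₁ * (t ^ 10) ^ 2 : ℝ) + 1 =
      t ^ 23 * (δ * (1 + u) ^ 12 * u ^ 11 + D₁ * u ^ 3 + u ^ 23) := by
    linear_combination (-(δ : ℝ)) * hTu - (δ * t ^ 12 * (1 + u) ^ 12 : ℝ) * htn 11 -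
      (D₁ * t ^ 20 : ℝ) * htn 3 - htn 23
  have hfin : (w : ℝ) * #{n ∈ Ico (C * t ^ 24) (C * (t + 1) ^ 24) | ¬ R n} ≤
      ((C * (t + 1) ^ 24 - C * t ^ 24 : ℕ) : ℝ) := by
    rw [hWr]
    have e5 := mul_lt_mul_of_pos_left h4 (pow_pos ht' 23)
    have e6 : (#{n ∈ Ico (C * t ^ 24) (C * (t + 1) ^ 24) | ¬ R n} : ℝ) ≤
      t ^ 23 * (C * stepPoly u * (2 + u * stepPoly u)) +
        t ^ 23 * (δ * (1 + u) ^ 12 * u ^ 11 + D₁ * u ^ 3 + u ^ 23) -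
        (t : ℝ) ^ 23 * (2 * C * stepPoly u ^ 2 / G u) := by linarith
    have e7 := mul_le_mul_of_nonneg_left e6 hw'.le
    linarith
  exact_mod_cast hfin

theorem exists_card_range_not_ternQuad_le {A α B γ C δ M w : ℕ} (hA : 0 < A) (hB : 0 < B)
    (hC : 0 < C) (hw : 0 < w)
    (hM : ∀ p : ℕ, p.Prime → p ∣ M → p ∣ A ∧ ¬ p ∣ α)
    (hM' : ∀ p : ℕ, p.Prime → ¬ p ∣ M → ¬ p ∣ 2 * A * B * C)
    (hMw : ∀ p : ℕ, p.Prime → p ≤ w → p ∣ M) {R : ℕ → Prop} [DecidablePred R]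
    (hR : ∀ z, R (ternQuad A α B γ C δ z)) :
    ∃ K : ℕ, ∀ N : ℕ, w * #{n ∈ range N | ¬ R n} ≤ K + 2 ^ 24 * N := by
  obtain ⟨t₀, ht₀⟩ := Filter.eventually_atTop.1
    (eventually_card_window_le (δ := δ) hA hB hC hw hM hM' hMw hR)
  have hstep : ∀ t, t₀ ≤ t → w * #{n ∈ range (C * t ^ 24) | ¬ R n} ≤
      w * (C * t₀ ^ 24) + C * t ^ 24 := by
    intro t ht
    induction t, ht using Nat.le_induction with
    | base =>
      have : #{n ∈ range (C * t₀ ^ 24) | ¬ R n} ≤ C * t₀ ^ 24 :=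
        (card_filter_le _ _).trans (card_range _).le
      exact (Nat.mul_le_mul_left w this).trans (Nat.le_add_right _ _)
    | succ t ht ih =>
      have hle : C * t ^ 24 ≤ C * (t + 1) ^ 24 :=
        Nat.mul_le_mul_left C (Nat.pow_le_pow_left (Nat.le_succ t) 24)
      have h1 : {n ∈ range (C * (t + 1) ^ 24) | ¬ R n} ⊆ {n ∈ range (C * t ^ 24) | ¬ R n} ∪
          {n ∈ Ico (C * t ^ 24) (C * (t + 1) ^ 24) | ¬ R n} := by
        intro n hn
        rw [mem_filter, mem_range] at hn
        rw [mem_union, mem_filter, mem_filter, mem_range, mem_Ico]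
        rcases lt_or_ge n (C * t ^ 24) with h | h
        · exact Or.inl ⟨h, hn.2⟩
        · exact Or.inr ⟨⟨h, hn.1⟩, hn.2⟩
      have h2 := Nat.mul_le_mul_left w ((card_le_card h1).trans (card_union_le _ _))
      have h3 := ht₀ t ht
      rw [mul_add] at h2
      omega
  refine ⟨w * (C * t₀ ^ 24) + w * (C * (t₀ + 1) ^ 24) + C * 2 ^ 24, fun N => ?_⟩
  have hmono : ∀ N' : ℕ, N ≤ N' → #{n ∈ range N | ¬ R n} ≤ #{n ∈ range N' | ¬ R n} :=
    fun N' h => card_le_card (filter_subset_filter _ (range_subset_range.2 h))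
  have hex : ∃ t, N ≤ C * t ^ 24 := by
    refine ⟨N, ?_⟩
    calc N ≤ N ^ 24 := Nat.le_self_pow (by norm_num) N
      _ ≤ C * N ^ 24 := Nat.le_mul_of_pos_left _ hC
  classical
  have hspec := Nat.find_spec hex
  set t := Nat.find hex with ht
  rcases lt_or_ge t (t₀ + 2) with h | h
  · have h1 : #{n ∈ range N | ¬ R n} ≤ N := (card_filter_le _ _).trans (card_range _).le
    have h2 : N ≤ C * (t₀ + 1) ^ 24 := hspec.trans
      (Nat.mul_le_mul_left C (Nat.pow_le_pow_left (by omega) 24))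
    have := Nat.mul_le_mul_left w (h1.trans h2)
    omega
  · obtain ⟨m, hm⟩ : ∃ m, t = m + 1 := ⟨t - 1, by omega⟩
    have h1 : C * m ^ 24 < N := not_le.1 (Nat.find_min hex (m := m) (by omega))
    have h2 := (Nat.mul_le_mul_left w (hmono _ hspec)).trans (hstep t (by omega))
    have h3 : t ^ 24 ≤ 2 ^ 24 * m ^ 24 := by
      rw [← mul_pow]
      exact Nat.pow_le_pow_left (by omega) 24
    have h4 := Nat.mul_le_mul_left C h3
    have h5 : C * (2 ^ 24 * m ^ 24) = 2 ^ 24 * (C * m ^ 24) := by ring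
    omega

theorem two_mul_triangular (z : ℕ) : 2 * triangular z = z * (z + 1) :=
  Nat.mul_div_cancel' (Nat.even_mul_succ_self z).two_dvd

theorem asympUniversal_of_forall_card_le {sol : ℕ → Prop} [DecidablePred sol] {c : ℕ}
    (h : ∀ w : ℕ, 0 < w → ∃ K : ℕ, ∀ N : ℕ, w * #{n ∈ range N | ¬ sol n} ≤ K + c * N) :
    AsympUniversal sol := by
  rw [AsympUniversal, Metric.tendsto_atTop]
  intro ε hε
  obtain ⟨w, hw⟩ := exists_nat_gt (2 * (c + 1) / ε)
  have hw0 : (0 : ℝ) < w := lt_trans (by positivity) hw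
  obtain ⟨K, hK⟩ := h w (by exact_mod_cast hw0)
  refine ⟨K + 1, fun N hN => ?_⟩
  have hN0 : (0 : ℝ) < N := by exact_mod_cast (Nat.succ_pos K).trans_le hN
  have hset : {n : ℕ | n < N ∧ ¬ sol n} = ({n ∈ range N | ¬ sol n} : Finset ℕ) := by
    ext n; simp
  have h1 : (w : ℝ) * #{n ∈ range N | ¬ sol n} ≤ K + c * N := by exact_mod_cast hK N
  have h2 : (K : ℝ) ≤ N := by exact_mod_cast (Nat.le_succ K).trans hN
  rw [Real.dist_eq, sub_zero, hset, Set.ncard_coe_finset, abs_of_nonneg (by positivity),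
    div_lt_iff₀ hN0]
  rw [div_lt_iff₀ hε] at hw
  have h3 : (w : ℝ) * #{n ∈ range N | ¬ sol n} < w * (ε * N) := by nlinarith
  exact lt_of_mul_lt_mul_left h3 hw0.le

theorem exists_card_range_not_le_of_residues {sol : ℕ → Prop} [DecidablePred sol] {w c M : ℕ}
    (hM : 0 < M) (h : ∀ n₀ : ℕ, ∃ f₀ K : ℕ, f₀ ≡ n₀ [MOD M] ∧
      ∀ N : ℕ, w * #{m ∈ range N | ¬ sol (f₀ + M * m)} ≤ K + c * N) :
    ∃ K : ℕ, ∀ N : ℕ, w * #{n ∈ range N | ¬ sol n} ≤ K + c * N := by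
  choose f K hf hK using h
  refine ⟨∑ r ∈ range M, (w * f r + K r + c), fun N => ?_⟩
  have hr : ∀ r ∈ range M, w * #{n ∈ {n ∈ range N | ¬ sol n} | n % M = r} ≤
      w * f r + K r + c + c * (N / M) := by
    intro r hr
    have hsub : {n ∈ {n ∈ range N | ¬ sol n} | n % M = r} ⊆ range (f r) ∪
        ({m ∈ range (N / M + 1) | ¬ sol (f r + M * m)}).image fun m => f r + M * m := by
      intro n hn
      rw [mem_filter, mem_filter, mem_range] at hn
      obtain ⟨⟨hnN, hns⟩, hnr⟩ := hn
      rw [mem_union, mem_range, mem_image]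
      rcases lt_or_ge n (f r) with h | h
      · exact Or.inl h
      · have h1 : f r ≡ n [MOD M] := by
          refine (hf r).trans ?_
          rw [← hnr]
          exact Nat.mod_modEq n M
        obtain ⟨m, hm⟩ := (Nat.modEq_iff_dvd' h).1 h1
        have hn' : f r + M * m = n := by omega
        refine Or.inr ⟨m, ?_, hn'⟩
        rw [mem_filter, mem_range, hn', Nat.lt_succ_iff, Nat.le_div_iff_mul_le hM, mul_comm]
        exact ⟨by omega, hns⟩
    have h1 := (card_le_card hsub).trans ((card_union_le _ _).trans
      (Nat.add_le_add_left card_image_le _))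
    rw [card_range] at h1
    have h2 := Nat.mul_le_mul_left w h1
    have h3 := hK r (N / M + 1)
    rw [mul_add] at h2 h3
    omega
  calc w * #{n ∈ range N | ¬ sol n}
      = ∑ r ∈ range M, w * #{n ∈ {n ∈ range N | ¬ sol n} | n % M = r} := by
        rw [← mul_sum, ← card_eq_sum_card_fiberwise]
        exact fun n _ => mem_coe.2 (mem_range.2 (Nat.mod_lt n hM))
    _ ≤ ∑ r ∈ range M, (w * f r + K r + c + c * (N / M)) := sum_le_sum hr
    _ = ∑ r ∈ range M, (w * f r + K r + c) + c * (M * (N / M)) := by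
        rw [sum_add_distrib, sum_const, card_range, smul_eq_mul]
        ring
    _ ≤ _ := by
        gcongr
        exact Nat.mul_div_le N M

/-- Solubility of `a x² + b y² + c t_z = n₀` modulo `m`, cleared of denominators, with a solution
for which `2 z + 1` is not divisible by the square of a prime factor of `m`. -/
def LocSol (a b c n₀ m : ℕ) : Prop :=
  ∃ x y z : ℕ, 2 * a * x ^ 2 + 2 * b * y ^ 2 + c * (z * (z + 1)) ≡ 2 * n₀ [MOD m] ∧
    ∀ p : ℕ, p.Prime → p ∣ m → ¬ p ^ 2 ∣ 2 * z + 1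

theorem LocSol.of_primePow {a b c n₀ : ℕ}
    (h : ∀ p j : ℕ, p.Prime → 2 ≤ j → LocSol a b c n₀ (p ^ j)) {m : ℕ} (hm0 : m ≠ 0)
    (hm : ∀ p : ℕ, p.Prime → p ∣ m → p ^ 2 ∣ m) : LocSol a b c n₀ m := by
  induction m using Nat.recOnPosPrimePosCoprime with
  | zero => exact absurd rfl hm0
  | one => exact ⟨0, 0, 0, Nat.modEq_one, fun p hp h1 => absurd (Nat.dvd_one.1 h1) hp.one_lt.ne'⟩
  | prime_pow p j hp hj =>
    refine h p j hp ?_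
    have := hm p hp (dvd_pow_self p hj.ne')
    exact (Nat.pow_dvd_pow_iff_le_right hp.one_lt).1 this
  | coprime k l hk hl hkl ihk ihl =>
    obtain ⟨x, y, z, h1, h2⟩ := ihk (by omega) fun p hp hpk =>
      Nat.Coprime.dvd_of_dvd_mul_right
        (Nat.Coprime.pow_left 2 (hkl.coprime_dvd_left hpk)) (hm p hp (hpk.mul_right l))
    obtain ⟨x', y', z', h1', h2'⟩ := ihl (by omega) fun p hp hpl =>
      Nat.Coprime.dvd_of_dvd_mul_left
        (Nat.Coprime.pow_left 2 (hkl.symm.coprime_dvd_left hpl)) (hm p hp (hpl.mul_left k))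
    have hk2 : ∀ p : ℕ, p.Prime → p ∣ k → p ^ 2 ∣ k := fun p hp hpk =>
      Nat.Coprime.dvd_of_dvd_mul_right
        (Nat.Coprime.pow_left 2 (hkl.coprime_dvd_left hpk)) (hm p hp (hpk.mul_right l))
    have hl2 : ∀ p : ℕ, p.Prime → p ∣ l → p ^ 2 ∣ l := fun p hp hpl =>
      Nat.Coprime.dvd_of_dvd_mul_left
        (Nat.Coprime.pow_left 2 (hkl.symm.coprime_dvd_left hpl)) (hm p hp (hpl.mul_left k))
    obtain ⟨X, hX, hX'⟩ := Nat.chineseRemainder hkl x x'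
    obtain ⟨Y, hY, hY'⟩ := Nat.chineseRemainder hkl y y'
    obtain ⟨Z, hZ, hZ'⟩ := Nat.chineseRemainder hkl z z'
    have hmod : ∀ {m x y z X Y Z : ℕ}, X ≡ x [MOD m] → Y ≡ y [MOD m] → Z ≡ z [MOD m] →
        2 * a * X ^ 2 + 2 * b * Y ^ 2 + c * (Z * (Z + 1)) ≡
        2 * a * x ^ 2 + 2 * b * y ^ 2 + c * (z * (z + 1)) [MOD m] := fun hx hy hz =>
      Nat.ModEq.add (Nat.ModEq.add ((hx.pow 2).mul_left _) ((hy.pow 2).mul_left _))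
        ((hz.mul (hz.add_right 1)).mul_left _)
    have hdvd : ∀ {m z Z p : ℕ}, Z ≡ z [MOD m] → p ^ 2 ∣ m → p ^ 2 ∣ 2 * Z + 1 →
        p ^ 2 ∣ 2 * z + 1 := fun hz hp hZ =>
      ((Nat.ModEq.dvd_iff ((hz.mul_left 2).add_right 1) hp).1 hZ)
    refine ⟨X, Y, Z, (Nat.modEq_and_modEq_iff_modEq_mul hkl).1
      ⟨(hmod hX hY hZ).trans h1, (hmod hX' hY' hZ').trans h1'⟩, fun p hp hpkl hsq => ?_⟩
    rcases (Nat.Prime.dvd_mul hp).1 hpkl with hpk | hpl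
    · exact h2 p hp hpk (hdvd hZ (hk2 p hp hpk) hsq)
    · exact h2' p hp hpl (hdvd hZ' (hl2 p hp hpl) hsq)

theorem asympUniversal_of_locSol {a b c : ℕ} (ha : 0 < a) (hb : 0 < b) (hc : 0 < c)
    (h : ∀ n₀ p j : ℕ, p.Prime → 2 ≤ j → LocSol a b c n₀ (p ^ j)) :
    AsympUniversal (fun n => ∃ (x y : ℤ) (z : ℕ),
      a * x ^ 2 + b * y ^ 2 + c * (triangular z : ℤ) = n) := by
  classical
  refine asympUniversal_of_forall_card_le (c := 2 ^ 24) fun w hw => ?_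
  obtain ⟨R₀, hR₀⟩ : ∃ R₀, R₀ = 2 * a * b * c * w.factorial := ⟨_, rfl⟩
  have hR₀pos : 0 < R₀ := by rw [hR₀]; have := w.factorial_pos; positivity
  have hcR : c ∣ R₀ := ⟨2 * a * b * w.factorial, by rw [hR₀]; ring⟩
  have haR : a ∣ R₀ := ⟨2 * b * c * w.factorial, by rw [hR₀]; ring⟩
  have hbR : b ∣ R₀ := ⟨2 * a * c * w.factorial, by rw [hR₀]; ring⟩
  have h2R : 2 ∣ R₀ := ⟨a * b * c * w.factorial, by rw [hR₀]; ring⟩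
  have hwR : w.factorial ∣ R₀ := ⟨2 * a * b * c, by rw [hR₀]; ring⟩
  obtain ⟨M, hM⟩ : ∃ M, M = c * R₀ ^ 3 := ⟨_, rfl⟩
  have hMpos : 0 < M := by rw [hM]; positivity
  refine exists_card_range_not_le_of_residues hMpos fun n₀ => ?_
  have hprime : ∀ p : ℕ, p.Prime → p ∣ M → p ∣ R₀ := fun p hp hpM => by
    rcases hp.dvd_mul.1 (hM ▸ hpM) with h | h
    · exact h.trans hcR
    · exact hp.dvd_of_dvd_pow h
  obtain ⟨x₀, y₀, z₀, h1, h2⟩ := LocSol.of_primePow (h n₀) (m := 2 * M) (by positivity)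
    fun p hp hpM => by
      have h3 : p ∣ R₀ := by
        rcases hp.dvd_mul.1 hpM with h | h
        · exact h.trans h2R
        · exact hprime p hp h
      calc p ^ 2 ∣ R₀ ^ 2 := pow_dvd_pow_of_dvd h3 2
        _ ∣ 2 * M := ⟨2 * c * R₀, by rw [hM]; ring⟩
  set f₀ := a * x₀ ^ 2 + b * y₀ ^ 2 + c * triangular z₀ with hf₀
  have hf : f₀ ≡ n₀ [MOD M] := by
    refine Nat.ModEq.mul_left_cancel' two_ne_zero ?_
    rw [hf₀, mul_add, mul_left_comm 2 c, two_mul_triangular]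
    convert h1 using 1
    ring
  obtain ⟨g, hg⟩ : ∃ g, g = Nat.gcd (2 * z₀ + 1) R₀ := ⟨_, rfl⟩
  obtain ⟨R₁, hR₁⟩ : g ∣ R₀ := hg ▸ Nat.gcd_dvd_right _ _
  obtain ⟨α, hα⟩ : g ∣ 2 * z₀ + 1 := hg ▸ Nat.gcd_dvd_left _ _
  obtain ⟨R', hR'⟩ : ∃ R', R' = R₀ * R₁ ^ 2 := ⟨_, rfl⟩
  have hMg : M = c * g ^ 2 * R' := by rw [hM, hR', hR₁]; ring
  have hR'pos : 0 < R' := Nat.pos_of_ne_zero fun h0 => by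
    rw [hMg, h0, mul_zero] at hMpos; exact lt_irrefl 0 hMpos
  have hmain := exists_card_range_not_ternQuad_le (A := 2 * R') (α := α) (B := b * M)
    (γ := 2 * b * y₀) (C := a * M) (δ := 2 * a * x₀) (M := R₀) (w := w)
    (by positivity) (by positivity) (by positivity) hw
    (fun p hp hpR => ⟨(hpR.trans ⟨R₁ ^ 2, hR'⟩).mul_left 2, fun hpα => by
      have h3 : p ∣ 2 * z₀ + 1 := hpα.trans ⟨g, by rw [hα, mul_comm]⟩
      have h4 : p ∣ g := hg ▸ Nat.dvd_gcd h3 hpR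
      refine h2 p hp ((hpR.trans ⟨c * R₀ ^ 2, by rw [hM]; ring⟩).mul_left 2) ?_
      rw [sq, hα]
      exact mul_dvd_mul h4 hpα⟩)
    (fun p hp hpR hp4 => hpR (by
      have hR'M : R' ∣ M := ⟨c * g ^ 2, by rw [hMg]; ring⟩
      rcases hp.dvd_mul.1 hp4 with h5 | h5
      · rcases hp.dvd_mul.1 h5 with h5 | h5
        · rcases hp.dvd_mul.1 h5 with h5 | h5
          · exact h5.trans h2R
          · rcases hp.dvd_mul.1 h5 with h5 | h5
            · exact h5.trans h2R
            · exact hprime p hp (h5.trans hR'M)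
        · rcases hp.dvd_mul.1 h5 with h5 | h5
          · exact h5.trans hbR
          · exact hprime p hp h5
      · rcases hp.dvd_mul.1 h5 with h5 | h5
        · exact h5.trans haR
        · exact hprime p hp h5))
    (fun p hp hpw => (hp.dvd_factorial.2 hpw).trans hwR)
    (R := fun m => ∃ (x y : ℤ) (z : ℕ),
      a * x ^ 2 + b * y ^ 2 + c * (triangular z : ℤ) = ((f₀ + M * m : ℕ) : ℤ))
    (by
      rintro ⟨⟨s, v⟩, x⟩
      refine ⟨((x₀ + M * x : ℕ) : ℤ), ((y₀ + M * v : ℕ) : ℤ), z₀ + 2 * g * R' * s, ?_⟩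
      have e : a * (x₀ + M * x) ^ 2 + b * (y₀ + M * v) ^ 2 +
          c * triangular (z₀ + 2 * g * R' * s) =
          f₀ + M * ternQuad (2 * R') α (b * M) (2 * b * y₀) (a * M) (2 * a * x₀) ((s, v), x) := by
        refine Nat.eq_of_mul_eq_mul_left two_pos ?_
        rw [mul_add, mul_left_comm 2 c, two_mul_triangular, mul_add 2 f₀, hf₀, mul_add 2 _ (c * _),
          mul_left_comm 2 c, two_mul_triangular, ternQuad]
        dsimp only
        zify at hα hMg ⊢
        linear_combination (2 * c * g * R' * s : ℤ) * hα -
          (4 * R' * s ^ 2 + 2 * α * s : ℤ) * hMg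
      exact_mod_cast e)
  obtain ⟨K, hK⟩ := hmain
  exact ⟨f₀, K, hf, hK⟩

end Density

theorem dvd_oddPart_iff {p a : ℕ} (hp : p.Prime) (ha : 0 < a) :
    p ∣ oddPart a ↔ p ∣ a ∧ p ≠ 2 := by
  have h := Nat.ordProj_mul_ordCompl_eq_self a 2
  constructor
  · refine fun h1 => ⟨h1.trans (Nat.ordCompl_dvd a 2), ?_⟩
    rintro rfl
    exact Nat.not_dvd_ordCompl Nat.prime_two ha.ne' h1
  · rintro ⟨h1, h2⟩
    rw [← h] at h1
    refine (hp.dvd_mul.1 h1).resolve_left fun h3 => h2 ?_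
    exact (Nat.prime_dvd_prime_iff_eq hp Nat.prime_two).1 (hp.dvd_of_dvd_pow h3)

theorem exists_lift_quadratic {p : ℕ} (hp : p.Prime) {α β κ z : ℤ}
    (h : (p : ℤ) ∣ α * z ^ 2 + β * z + κ) (h' : ¬ (p : ℤ) ∣ 2 * α * z + β) (j : ℕ) :
    ∃ z' : ℤ, (p : ℤ) ^ j ∣ α * z' ^ 2 + β * z' + κ ∧ (p : ℤ) ∣ z' - z := by
  rcases Nat.eq_zero_or_pos j with rfl | hj
  · exact ⟨z, by simp, by simp⟩
  induction j, hj using Nat.le_induction with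
  | base => exact ⟨z, by simpa using h, by simp⟩
  | succ j hj ih =>
    obtain ⟨y, ⟨k, hk⟩, l, hl⟩ := ih
    have hpz : Prime (p : ℤ) := Nat.prime_iff_prime_int.1 hp
    have hy : ¬ (p : ℤ) ∣ 2 * α * y + β := fun hd => h' (by
      have : 2 * α * z + β = (2 * α * y + β) - p * (2 * α * l) := by
        linear_combination (-2 * α) * hl
      rw [this]
      exact dvd_sub hd (dvd_mul_right _ _))
    obtain ⟨r, s, hrs⟩ := (hpz.coprime_iff_not_dvd).2 hy
    obtain ⟨i, rfl⟩ : ∃ i, j = i + 1 := ⟨j - 1, by omega⟩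
    refine ⟨y - p ^ (i + 1) * (s * k), ⟨k * r + α * p ^ i * (s * k) ^ 2, ?_⟩,
      l - p ^ i * (s * k), ?_⟩
    · linear_combination hk + (-(p : ℤ) ^ (i + 1) * k) * hrs
    · linear_combination hl

theorem exists_sq_of_legendreSym_eq_one {p : ℕ} (hp : p.Prime) (hp2 : p ≠ 2) {d : ℤ}
    (h : @legendreSym p ⟨hp⟩ d = 1) (j : ℕ) :
    ¬ (p : ℤ) ∣ d ∧ ∃ u : ℤ, (p : ℤ) ^ j ∣ u ^ 2 - d ∧ ¬ (p : ℤ) ∣ u := by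
  have : Fact p.Prime := ⟨hp⟩
  have hpz : Prime (p : ℤ) := Nat.prime_iff_prime_int.1 hp
  have hd : (d : ZMod p) ≠ 0 := fun h0 => by
    rw [(legendreSym.eq_zero_iff p d).2 h0] at h
    exact zero_ne_one h
  have hpd : ¬ (p : ℤ) ∣ d := fun h0 => hd ((ZMod.intCast_zmod_eq_zero_iff_dvd d p).2 h0)
  obtain ⟨r, hr⟩ := (legendreSym.eq_one_iff p hd).1 h
  obtain ⟨r, rfl⟩ := ZMod.intCast_surjective r
  have hr' : (p : ℤ) ∣ r ^ 2 - d := by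
    rw [← ZMod.intCast_zmod_eq_zero_iff_dvd]
    push_cast
    rw [hr, sq, sub_self]
  have hsq : ∀ u : ℤ, (p : ℤ) ∣ u ^ 2 - d → ¬ (p : ℤ) ∣ u := fun u hu hpu => hpd (by
    have := dvd_sub (dvd_pow hpu two_ne_zero) hu
    rwa [sub_sub_cancel] at this)
  have h2 : ¬ (p : ℤ) ∣ 2 * 1 * r + 0 := fun h0 => by
    rw [mul_one, add_zero] at h0
    rcases hpz.dvd_mul.1 h0 with h1 | h1
    · exact hp2 ((Nat.prime_dvd_prime_iff_eq hp Nat.prime_two).1 (by exact_mod_cast h1))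
    · exact hsq r hr' h1
  obtain ⟨u, hu, hur⟩ := exists_lift_quadratic hp (α := 1) (β := 0) (κ := -d) (z := r)
    (by convert hr' using 1; ring) h2 j
  refine ⟨hpd, u, by convert hu using 1; ring, fun hpu => hsq r hr' ?_⟩
  have := dvd_sub hpu hur
  rwa [sub_sub_cancel] at this

theorem LocSol.of_int {a b c n₀ p j : ℕ} (hp : p.Prime) (hj : 2 ≤ j) {x y z : ℤ}
    (h : (p : ℤ) ^ j ∣ 2 * a * x ^ 2 + 2 * b * y ^ 2 + c * (z * (z + 1)) - 2 * n₀)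
    (h' : ¬ (p : ℤ) ^ 2 ∣ 2 * z + 1) : LocSol a b c n₀ (p ^ j) := by
  have hpj : (0 : ℤ) < (p : ℤ) ^ j := pow_pos (by exact_mod_cast hp.pos) j
  have key : ∀ t : ℤ, ∃ n : ℕ, (p : ℤ) ^ j ∣ n - t := fun t => by
    refine ⟨(t % (p : ℤ) ^ j).toNat, ?_⟩
    rw [Int.toNat_of_nonneg (Int.emod_nonneg _ hpj.ne')]
    exact (Int.mod_modEq t _).symm.dvd
  obtain ⟨X, hX⟩ := key x
  obtain ⟨Y, hY⟩ := key y
  obtain ⟨Z, hZ⟩ := key z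
  refine ⟨X, Y, Z, ?_, fun q hq hqp hsq => h' ?_⟩
  · rw [← Int.natCast_modEq_iff, Int.modEq_comm, Int.modEq_iff_dvd]
    push_cast
    have e : (2 * a * X ^ 2 + 2 * b * Y ^ 2 + c * (Z * (Z + 1)) - 2 * n₀ : ℤ) =
        (2 * a * x ^ 2 + 2 * b * y ^ 2 + c * (z * (z + 1)) - 2 * n₀) +
        (X - x) * (2 * a * (X + x)) + (Y - y) * (2 * b * (Y + y)) +
          (Z - z) * (c * (Z + z + 1)) := by ring
    rw [e]
    exact dvd_add (dvd_add (dvd_add h (hX.mul_right _)) (hY.mul_right _)) (hZ.mul_right _)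
  · obtain rfl := (Nat.prime_dvd_prime_iff_eq hq hp).1 (hq.dvd_of_dvd_pow hqp)
    have h1 : (q : ℤ) ^ 2 ∣ 2 * Z + 1 := by exact_mod_cast hsq
    have h2 : (q : ℤ) ^ 2 ∣ Z - z := (pow_dvd_pow _ hj).trans hZ
    have e : 2 * z + 1 = (2 * Z + 1) - (Z - z) * 2 := by ring
    rw [e]
    exact dvd_sub h1 (h2.mul_right _)

theorem LocSol.of_cofactor {a b c n₀ p j e c₁ : ℕ} (hp : p.Prime) (hj : 2 ≤ j) (hc : c = e * c₁)
    (hc₁ : ¬ p ∣ c₁) {x y m : ℤ} (hxy : a * x ^ 2 + b * y ^ 2 - n₀ = e * m)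
    (hm : (p : ℤ) ∣ 2 * m) : LocSol a b c n₀ (p ^ j) := by
  obtain ⟨z, hz, hz0⟩ := exists_lift_quadratic hp (α := c₁) (β := c₁) (κ := 2 * m) (z := 0)
    (by simpa using hm) (by rw [mul_zero, zero_add]; exact_mod_cast hc₁) j
  refine LocSol.of_int hp hj (x := x) (y := y) (z := z) ?_ fun h => ?_
  · obtain ⟨k, hk⟩ := hz
    refine ⟨e * k, ?_⟩
    rw [hc]
    push_cast
    linear_combination 2 * hxy + e * hk
  · have h1 : (p : ℤ) ∣ 2 * z + 1 := (dvd_pow_self _ two_ne_zero).trans h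
    rw [sub_zero] at hz0
    have h2 := dvd_sub h1 (hz0.mul_left 2)
    rw [add_sub_cancel_left] at h2
    exact (Nat.prime_iff_prime_int.1 hp).not_dvd_one h2

theorem LocSol.of_int_odd {a b c n₀ p j : ℕ} (hp : p.Prime) (hp2 : p ≠ 2) (hj : 2 ≤ j) {x y w : ℤ}
    (h : (p : ℤ) ^ j ∣ 8 * a * x ^ 2 + 8 * b * y ^ 2 + c * w ^ 2 - (8 * n₀ + c))
    (h' : ¬ (p : ℤ) ^ 2 ∣ w) : LocSol a b c n₀ (p ^ j) := by
  have hcop : IsCoprime ((p : ℤ) ^ j) 2 := by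
    have : Nat.Coprime (p ^ j) 2 := Nat.Coprime.pow_left j
      ((Nat.coprime_primes hp Nat.prime_two).2 hp2)
    exact_mod_cast Nat.isCoprime_iff_coprime.2 this
  obtain ⟨r, s, hrs⟩ := hcop
  refine LocSol.of_int hp hj (x := x) (y := y) (z := s * (w - 1)) ?_ fun h1 => h' ?_
  · have h4 : IsCoprime ((p : ℤ) ^ j) 4 := by
      have := (show IsCoprime ((p : ℤ) ^ j) 2 from ⟨r, s, hrs⟩).pow_right (n := 2)
      norm_num at this
      exact this
    refine h4.dvd_of_dvd_mul_left ?_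
    obtain ⟨k, hk⟩ := h
    refine ⟨k - c * (r * (w - 1)) * (2 * s * (w - 1) + 1 + w), ?_⟩
    linear_combination hk + (c * (w - 1) * (2 * s * (w - 1) + 1 + w) : ℤ) * hrs
  · have h2 : (p : ℤ) ^ 2 ∣ p ^ j * (r * (w - 1)) := (pow_dvd_pow _ hj).mul_right _
    have e : w = (2 * (s * (w - 1)) + 1) + p ^ j * (r * (w - 1)) := by
      linear_combination (-(w - 1)) * hrs
    rw [e]
    exact dvd_add h1 h2

theorem LocSol.swap {a b c n₀ m : ℕ} (h : LocSol a b c n₀ m) : LocSol b a c n₀ m := by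
  obtain ⟨x, y, z, h1, h2⟩ := h
  refine ⟨y, x, z, ?_, h2⟩
  rwa [add_comm (2 * b * y ^ 2)]

theorem isCoprime_prime_pow_of_not_dvd {p : ℕ} (hp : p.Prime) {d : ℤ} (h : ¬ (p : ℤ) ∣ d) (j : ℕ) :
    IsCoprime ((p : ℤ) ^ j) d :=
  (((Nat.prime_iff_prime_int.1 hp).coprime_iff_not_dvd).2 h).pow_left

theorem exists_mul_eq_one_add_of_isCoprime {P d : ℤ} (h : IsCoprime P d) :
    ∃ i r : ℤ, d * i = 1 + P * r := by
  obtain ⟨r, s, h⟩ := h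
  exact ⟨s, -r, by linear_combination h⟩

theorem Nat.Prime.not_intCast_dvd_two {p : ℕ} (hp : p.Prime) (hp2 : p ≠ 2) : ¬ (p : ℤ) ∣ 2 :=
  fun h => hp2 ((Nat.prime_dvd_prime_iff_eq hp Nat.prime_two).1 (by exact_mod_cast h))

theorem LocSol.of_not_dvd {a b c n₀ p j : ℕ} (hp : p.Prime) (hp2 : p ≠ 2) (hj : 2 ≤ j)
    (ha : ¬ p ∣ a) (hb : ¬ p ∣ b) (hc : ¬ p ∣ c) : LocSol a b c n₀ (p ^ j) := by
  have : Fact p.Prime := ⟨hp⟩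
  have ha' : (a : ZMod p) ≠ 0 := fun h => ha ((ZMod.natCast_eq_zero_iff a p).1 h)
  have hb' : (b : ZMod p) ≠ 0 := fun h => hb ((ZMod.natCast_eq_zero_iff b p).1 h)
  obtain ⟨x, y, hxy⟩ := FiniteField.exists_root_sum_quadratic
    (Polynomial.degree_quadratic (b := (0 : ZMod p)) (c := -(n₀ : ZMod p)) ha')
    (Polynomial.degree_quadratic (b := (0 : ZMod p)) (c := 0) hb')
    (by rw [ZMod.card]; exact hp.eq_two_or_odd.resolve_left hp2)
  obtain ⟨x, rfl⟩ := ZMod.intCast_surjective x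
  obtain ⟨y, rfl⟩ := ZMod.intCast_surjective y
  refine LocSol.of_cofactor hp hj (one_mul c).symm hc (x := x) (y := y)
    (m := a * x ^ 2 + b * y ^ 2 - n₀) (by push_cast; ring) (Dvd.dvd.mul_left ?_ 2)
  rw [← ZMod.intCast_zmod_eq_zero_iff_dvd]
  simp only [Polynomial.eval_add, Polynomial.eval_mul, Polynomial.eval_C, Polynomial.eval_pow,
    Polynomial.eval_X] at hxy
  push_cast
  linear_combination hxy

theorem LocSol.of_legendreSym_neg_mul {a b c n₀ p j : ℕ} (hp : p.Prime) (hp2 : p ≠ 2) (hj : 2 ≤ j)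
    (h : @legendreSym p ⟨hp⟩ (-((a : ℤ) * b)) = 1) : LocSol a b c n₀ (p ^ j) := by
  have hpz : Prime (p : ℤ) := Nat.prime_iff_prime_int.1 hp
  have h2 := hp.not_intCast_dvd_two hp2
  obtain ⟨hd, u, ⟨t, ht⟩, hu⟩ := exists_sq_of_legendreSym_eq_one hp hp2 h j
  have ha : ¬ (p : ℤ) ∣ 2 * a := fun hpa => by
    rcases hpz.dvd_mul.1 hpa with h3 | h3
    · exact h2 h3
    · exact hd ((h3.mul_right _).neg_right)
  have hu' : ¬ (p : ℤ) ∣ 2 * u := fun h3 => (hpz.dvd_mul.1 h3).elim h2 hu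
  have hcop := isCoprime_prime_pow_of_not_dvd hp ha j
  obtain ⟨i, r, hi⟩ := exists_mul_eq_one_add_of_isCoprime hcop
  obtain ⟨k, s, hk⟩ :=
    exists_mul_eq_one_add_of_isCoprime (isCoprime_prime_pow_of_not_dvd hp hu' j)
  refine LocSol.of_int hp hj (x := (1 + a * n₀) * i) (y := (a * n₀ - 1) * k) (z := 0)
    (hcop.dvd_of_dvd_mul_left
      ⟨(1 + a * n₀) ^ 2 * (2 * r + p ^ j * r ^ 2) + 4 * t * ((a * n₀ - 1) * k) ^ 2
        - (a * n₀ - 1) ^ 2 * (2 * s + p ^ j * s ^ 2), ?_⟩) fun h3 => ?_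
  · linear_combination ((1 + a * n₀) ^ 2 * (2 * a * i + 1 + p ^ j * r)) * hi
      - ((a * n₀ - 1) ^ 2 * (2 * u * k + 1 + p ^ j * s)) * hk + (4 * ((a * n₀ - 1) * k) ^ 2) * ht
  · exact hpz.not_dvd_one ((dvd_pow_self _ two_ne_zero).trans (by simpa using h3))

theorem LocSol.of_legendreSym_neg_two_mul {a b c n₀ p j : ℕ} (hp : p.Prime) (hp2 : p ≠ 2)
    (hj : 2 ≤ j) (h : @legendreSym p ⟨hp⟩ (-(2 * (b : ℤ) * c)) = 1) :
    LocSol a b c n₀ (p ^ j) := by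
  have hpz : Prime (p : ℤ) := Nat.prime_iff_prime_int.1 hp
  have h2 := hp.not_intCast_dvd_two hp2
  obtain ⟨hd, u, ⟨v, hv⟩, hu⟩ := exists_sq_of_legendreSym_eq_one hp hp2 h j
  have hc : ¬ (p : ℤ) ∣ c := fun h3 => hd ((h3.mul_left _).neg_right)
  obtain ⟨t, ht, htm⟩ : ∃ t : ℤ, ¬ (p : ℤ) ∣ t ∧ ¬ (p : ℤ) ^ 2 ∣ t ^ 2 + c * (8 * n₀ + c) := by
    by_cases h1 : (p : ℤ) ^ 2 ∣ 1 ^ 2 + c * (8 * n₀ + c)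
    · refine ⟨2, h2, fun h4 => ?_⟩
      have h3 := dvd_sub h4 h1
      have e : (2 ^ 2 + c * (8 * n₀ + c) - (1 ^ 2 + c * (8 * n₀ + c)) : ℤ) = 3 := by ring
      rw [e] at h3
      have h5 := Int.le_of_dvd (by norm_num) h3
      have h6 : (2 : ℤ) ≤ p := by exact_mod_cast hp.two_le
      nlinarith
    · exact ⟨1, hpz.not_dvd_one, h1⟩
  have h2ct : ¬ (p : ℤ) ∣ 2 * c * t := fun h3 => (hpz.dvd_mul.1 h3).elim
    (fun h4 => (hpz.dvd_mul.1 h4).elim h2 hc) ht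
  have h4ut : ¬ (p : ℤ) ∣ 2 * 2 * u * t := fun h3 => (hpz.dvd_mul.1 h3).elim
    (fun h4 => (hpz.dvd_mul.1 h4).elim (fun h5 => (hpz.dvd_mul.1 h5).elim h2 h2) hu) ht
  have hcop := isCoprime_prime_pow_of_not_dvd hp h2ct j
  have hcop' : IsCoprime ((p : ℤ) ^ j) (2 * c * t * (2 * t)) := hcop.mul_right
    (isCoprime_prime_pow_of_not_dvd hp (fun h3 => (hpz.dvd_mul.1 h3).elim h2 ht) j)
  obtain ⟨i, r, hi⟩ := exists_mul_eq_one_add_of_isCoprime hcop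
  obtain ⟨k, s, hk⟩ :=
    exists_mul_eq_one_add_of_isCoprime (isCoprime_prime_pow_of_not_dvd hp h4ut j)
  set m : ℤ := c * (8 * n₀ + c) with hm
  refine LocSol.of_int_odd hp hp2 hj (x := 0) (y := (m - t ^ 2) * k) (w := (t ^ 2 + m) * i)
    (hcop'.dvd_of_dvd_mul_left
      ⟨(t ^ 2 + m) ^ 2 * (2 * r + p ^ j * r ^ 2) - (m - t ^ 2) ^ 2 * (2 * s + p ^ j * s ^ 2)
        + 16 * t ^ 2 * v * ((m - t ^ 2) * k) ^ 2, ?_⟩) fun h3 => htm ?_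
  · linear_combination ((t ^ 2 + m) ^ 2 * (2 * c * t * i + 1 + p ^ j * r)) * hi
      - ((m - t ^ 2) ^ 2 * (2 * 2 * u * t * k + 1 + p ^ j * s)) * hk
      + (16 * t ^ 2 * ((m - t ^ 2) * k) ^ 2) * hv + 4 * t ^ 2 * hm
  · have e : t ^ 2 + m = (t ^ 2 + m) * i * (2 * c * t) - p ^ j * (r * (t ^ 2 + m)) := by
      linear_combination (-(t ^ 2 + m)) * hi
    rw [e]
    exact dvd_sub (h3.mul_right _) ((pow_dvd_pow _ hj).mul_right _)

theorem exists_dvd_sq_add_sq_sub_of_two {a b : ℕ} (h : ¬ (2 ∣ a ∧ 2 ∣ b)) (n : ℕ) :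
    ∃ x y m : ℤ, a * x ^ 2 + b * y ^ 2 - n = 2 * m := by
  have key : ∀ a b n : ZMod 2, ¬ (a = 0 ∧ b = 0) → ∃ x y : ZMod 2, a * x ^ 2 + b * y ^ 2 - n = 0 := by
    decide
  obtain ⟨x, y, hxy⟩ := key a b n (by simpa [ZMod.natCast_eq_zero_iff] using h)
  obtain ⟨x, rfl⟩ := ZMod.intCast_surjective x
  obtain ⟨y, rfl⟩ := ZMod.intCast_surjective y
  exact ⟨x, y, (ZMod.intCast_zmod_eq_zero_iff_dvd _ 2).1 (by push_cast; exact hxy)⟩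

theorem exists_dvd_sq_add_sq_sub_of_four {a b : ℕ} (h : 2 ∣ a * b ∧ ¬ 4 ∣ a * b) (n : ℕ) :
    ∃ x y m : ℤ, a * x ^ 2 + b * y ^ 2 - n = 4 * m := by
  have key : ∀ a b n : ZMod 4, a * b = 2 → ∃ x y : ZMod 4, a * x ^ 2 + b * y ^ 2 - n = 0 := by
    decide
  obtain ⟨x, y, hxy⟩ := key a b n (by
    have h2 : a * b ≡ 2 [MOD 4] := by simp only [Nat.ModEq]; omega
    exact_mod_cast (ZMod.natCast_eq_natCast_iff _ _ _).2 h2)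
  obtain ⟨x, rfl⟩ := ZMod.intCast_surjective x
  obtain ⟨y, rfl⟩ := ZMod.intCast_surjective y
  exact ⟨x, y, (ZMod.intCast_zmod_eq_zero_iff_dvd _ 4).1 (by push_cast; exact hxy)⟩

theorem LocSol.of_two {a b c n₀ j : ℕ} (hj : 2 ≤ j) (hgcd : Nat.gcd a (Nat.gcd b c) = 1)
    (h : ¬ (4 ∣ c) ∨ ((4 ∣ c ∧ ¬ (8 ∣ c)) ∧ (2 ∣ a * b ∧ ¬ (4 ∣ a * b)))) :
    LocSol a b c n₀ (2 ^ j) := by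
  by_cases h4 : 4 ∣ c
  · rcases h with h | ⟨⟨-, h8⟩, hab⟩
    · exact absurd h4 h
    obtain ⟨x, y, m, hxy⟩ := exists_dvd_sq_add_sq_sub_of_four hab n₀
    obtain ⟨d, rfl⟩ := h4
    exact LocSol.of_cofactor Nat.prime_two hj rfl (by omega) hxy ⟨m, rfl⟩
  by_cases h2 : 2 ∣ c
  · have hab : ¬ (2 ∣ a ∧ 2 ∣ b) := fun ⟨h5, h6⟩ => by
      have := Nat.dvd_gcd h5 (Nat.dvd_gcd h6 h2)
      omega
    obtain ⟨x, y, m, hxy⟩ := exists_dvd_sq_add_sq_sub_of_two hab n₀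
    obtain ⟨d, rfl⟩ := h2
    exact LocSol.of_cofactor Nat.prime_two hj rfl (by omega) hxy ⟨m, rfl⟩
  · exact LocSol.of_cofactor Nat.prime_two hj (one_mul c).symm h2 (x := 0) (y := 0)
      (m := -n₀) (by push_cast; ring) ⟨_, rfl⟩

theorem locSol_of_isQR {a b c : ℕ} (ha : 0 < a) (hb : 0 < b) (hc : 0 < c)
    (hgcd : Nat.gcd a (Nat.gcd b c) = 1) (hqa : isQR (-(2 * (b : ℤ) * c)) (oddPart a))
    (hqb : isQR (-(2 * (a : ℤ) * c)) (oddPart b)) (hqc : isQR (-((a : ℤ) * b)) (oddPart c))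
    (h2 : ¬ (4 ∣ c) ∨ ((4 ∣ c ∧ ¬ (8 ∣ c)) ∧ (2 ∣ a * b ∧ ¬ (4 ∣ a * b))))
    (n₀ p j : ℕ) (hp : p.Prime) (hj : 2 ≤ j) : LocSol a b c n₀ (p ^ j) := by
  rcases eq_or_ne p 2 with rfl | hp2
  · exact LocSol.of_two hj hgcd h2
  by_cases hpa : p ∣ a
  · exact LocSol.of_legendreSym_neg_two_mul hp hp2 hj
      (hqa p hp ((dvd_oddPart_iff hp ha).2 ⟨hpa, hp2⟩))
  by_cases hpb : p ∣ b
  · exact (LocSol.of_legendreSym_neg_two_mul hp hp2 hj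
      (hqb p hp ((dvd_oddPart_iff hp hb).2 ⟨hpb, hp2⟩))).swap
  by_cases hpc : p ∣ c
  · exact LocSol.of_legendreSym_neg_mul hp hp2 hj
      (hqc p hp ((dvd_oddPart_iff hp hc).2 ⟨hpc, hp2⟩))
  · exact LocSol.of_not_dvd hp hp2 hj hpa hpb hpc

theorem AsympUniversal.exists_modEq {sol : ℕ → Prop} (h : AsympUniversal sol) {m : ℕ} (hm : 0 < m)
    (r : ℕ) : ∃ n, n ≡ r [MOD m] ∧ sol n := by
  by_contra! hno
  have hm' : (0 : ℝ) < m := by exact_mod_cast hm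
  obtain ⟨N₀, hN₀⟩ := Metric.tendsto_atTop.1 h (1 / m) (by positivity)
  have h1 := hN₀ (m * (N₀ + 1)) (by nlinarith)
  have hsub : Set.range (fun k : Fin (N₀ + 1) => r % m + m * k) ⊆
      {n : ℕ | n < m * (N₀ + 1) ∧ ¬ sol n} := by
    rintro _ ⟨k, rfl⟩
    refine ⟨?_, hno _ ?_⟩
    · have h2 := Nat.mul_le_mul_left m (Nat.succ_le_of_lt k.2)
      have h3 := Nat.mod_lt r hm
      rw [Nat.succ_eq_add_one, mul_add, mul_one] at h2
      exact (Nat.add_lt_add_right h3 _).trans_le (by rwa [add_comm])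
    · simp [Nat.ModEq]
  have hfin : {n : ℕ | n < m * (N₀ + 1) ∧ ¬ sol n}.Finite :=
    (Set.finite_lt_nat (m * (N₀ + 1))).subset fun n hn => hn.1
  have hcard := Set.ncard_le_ncard hsub hfin
  rw [← Nat.card_coe_set_eq, Nat.card_range_of_injective
    (fun k l hkl => Fin.ext (Nat.eq_of_mul_eq_mul_left hm (Nat.add_left_cancel hkl))),
    Nat.card_fin] at hcard
  have hcard' : ((N₀ : ℝ) + 1) ≤ ({n : ℕ | n < m * (N₀ + 1) ∧ ¬ sol n}.ncard : ℝ) := by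
    exact_mod_cast hcard
  rw [Real.dist_eq, sub_zero, abs_of_nonneg (by positivity)] at h1
  push_cast at h1
  rw [div_lt_div_iff₀ (by positivity) hm'] at h1
  nlinarith

theorem not_forall_exists_mul_sq {p : ℕ} [Fact p.Prime] (hp2 : p ≠ 2) (c : ZMod p) :
    ¬ ∀ v, ∃ w, c * w ^ 2 = v := fun h => by
  have hsurj : Function.Surjective fun w : ZMod p => c * w ^ 2 := h
  have h1 : (1 : ZMod p) = -1 := Finite.injective_iff_surjective.2 hsurj (by simp)
  have : Fact (2 < p) := ⟨lt_of_le_of_ne (Fact.out : p.Prime).two_le hp2.symm⟩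
  exact ZMod.neg_one_ne_one h1.symm

theorem legendreSym_eq_one_of_forall_exists_dvd {p : ℕ} (hp : p.Prime) (hp2 : p ≠ 2) {A B C : ℤ}
    (hA : (p : ℤ) ∣ A)
    (h : ∀ v : ℤ, ∃ x y w : ℤ, (p : ℤ) ^ 2 ∣ A * x ^ 2 + B * y ^ 2 + C * w ^ 2 - v) :
    @legendreSym p ⟨hp⟩ (-(B * C)) = 1 := by
  have : Fact p.Prime := ⟨hp⟩
  have hp0 : (p : ℤ) ≠ 0 := by exact_mod_cast hp.ne_zero
  have hmod : ∀ v : ℤ, ∃ x y w : ℤ, (p : ℤ) ^ 2 ∣ A * x ^ 2 + B * y ^ 2 + C * w ^ 2 - v ∧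
      (B : ZMod p) * y ^ 2 + C * w ^ 2 = v := fun v => by
    obtain ⟨x, y, w, hv⟩ := h v
    refine ⟨x, y, w, hv, ?_⟩
    have h1 := (ZMod.intCast_zmod_eq_zero_iff_dvd _ p).2 ((dvd_pow_self _ two_ne_zero).trans hv)
    push_cast at h1
    rw [(ZMod.intCast_zmod_eq_zero_iff_dvd A p).2 hA] at h1
    linear_combination h1
  have hB : (B : ZMod p) ≠ 0 := fun hB => not_forall_exists_mul_sq hp2 (C : ZMod p) fun v => by
    obtain ⟨v, rfl⟩ := ZMod.intCast_surjective v
    obtain ⟨x, y, w, -, hv⟩ := hmod v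
    exact ⟨w, by rw [← hv, hB]; ring⟩
  have hC : (C : ZMod p) ≠ 0 := fun hC => not_forall_exists_mul_sq hp2 (B : ZMod p) fun v => by
    obtain ⟨v, rfl⟩ := ZMod.intCast_surjective v
    obtain ⟨x, y, w, -, hv⟩ := hmod v
    exact ⟨y, by rw [← hv, hC]; ring⟩
  rw [legendreSym.eq_one_iff p (by push_cast; exact neg_ne_zero.2 (mul_ne_zero hB hC))]
  by_contra hns
  obtain ⟨A, rfl⟩ := hA
  refine not_forall_exists_mul_sq hp2 (A : ZMod p) fun v => ?_
  obtain ⟨v, rfl⟩ := ZMod.intCast_surjective v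
  obtain ⟨x, y, w, hv, hyw⟩ := hmod (p * v)
  push_cast at hyw
  rw [ZMod.natCast_self, zero_mul] at hyw
  have hw : (w : ZMod p) = 0 := by
    by_contra hw
    refine hns ⟨B * y / w, ?_⟩
    field_simp
    push_cast
    linear_combination (-(B : ZMod p)) * hyw
  rw [hw] at hyw
  have hy : (y : ZMod p) = 0 := by
    simpa [hB] using hyw
  obtain ⟨w, rfl⟩ := (ZMod.intCast_zmod_eq_zero_iff_dvd w p).1 hw
  obtain ⟨y, rfl⟩ := (ZMod.intCast_zmod_eq_zero_iff_dvd y p).1 hy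
  refine ⟨x, ?_⟩
  have h2 : (p : ℤ) ∣ A * x ^ 2 - v := by
    refine (mul_dvd_mul_iff_left hp0).1 ?_
    have e : (p : ℤ) * (A * x ^ 2 - v) = (p * A * x ^ 2 + B * (p * y) ^ 2 + C * (p * w) ^ 2 - p * v)
        - p ^ 2 * (B * y ^ 2 + C * w ^ 2) := by ring
    rw [e, ← sq]
    exact dvd_sub hv (dvd_mul_right _ _)
  have h3 := (ZMod.intCast_zmod_eq_zero_iff_dvd _ p).2 h2
  push_cast at h3
  linear_combination h3

theorem legendreSym_eq_one_of_mul_sq {p : ℕ} (hp : p.Prime) {d k : ℤ}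
    (h : @legendreSym p ⟨hp⟩ (d * k ^ 2) = 1) : @legendreSym p ⟨hp⟩ d = 1 := by
  have : Fact p.Prime := ⟨hp⟩
  by_cases hk : (k : ZMod p) = 0
  · rw [(legendreSym.eq_zero_iff p _).2 (by push_cast; rw [hk]; ring)] at h
    exact absurd h zero_ne_one
  · rwa [legendreSym.mul, legendreSym.sq_one' p hk, mul_one] at h

section Necessity

variable {a b c : ℕ}

theorem exists_sq_dvd_of_asympUniversal
    (h : AsympUniversal fun n => ∃ (x y : ℤ) (z : ℕ),
      a * x ^ 2 + b * y ^ 2 + c * (triangular z : ℤ) = n)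
    {p : ℕ} (hp : p.Prime) (hp2 : p ≠ 2) (v : ℤ) :
    ∃ x y w : ℤ, (p : ℤ) ^ 2 ∣ 8 * a * x ^ 2 + 8 * b * y ^ 2 + c * w ^ 2 - v := by
  have hcop : IsCoprime ((p : ℤ) ^ 2) 8 := by
    have h1 := isCoprime_prime_pow_of_not_dvd hp (hp.not_intCast_dvd_two hp2) 2
    have h2 := h1.pow_right (n := 3)
    norm_num at h2
    exact h2
  obtain ⟨i, r, hi⟩ := exists_mul_eq_one_add_of_isCoprime hcop
  have hpos : (0 : ℤ) < (p : ℤ) ^ 2 := pow_pos (by exact_mod_cast hp.pos) 2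
  obtain ⟨n, hn, x, y, z, hxyz⟩ := h.exists_modEq (pow_pos hp.pos 2)
    (((v - c) * i) % (p : ℤ) ^ 2).toNat
  have h1 : (p : ℤ) ^ 2 ∣ (v - c) * i - n := by
    rw [← Int.natCast_modEq_iff] at hn
    push_cast at hn
    rw [Int.toNat_of_nonneg (Int.emod_nonneg _ hpos.ne')] at hn
    exact (hn.trans (Int.mod_modEq _ _)).dvd
  refine ⟨x, y, 2 * z + 1, ?_⟩
  obtain ⟨k, hk⟩ := h1
  have ht : (2 : ℤ) * triangular z = z * (z + 1) := by exact_mod_cast two_mul_triangular z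
  refine ⟨r * (v - c) - 8 * k, ?_⟩
  linear_combination 8 * hxyz - 8 * hk + (v - c) * hi - 4 * c * ht

theorem exists_eq_zmod_of_asympUniversal
    (h : AsympUniversal fun n => ∃ (x y : ℤ) (z : ℕ),
      a * x ^ 2 + b * y ^ 2 + c * (triangular z : ℤ) = n)
    {m : ℕ} [NeZero m] (hmc : m ∣ c) (v : ZMod m) :
    ∃ x y : ZMod m, (a : ZMod m) * x ^ 2 + b * y ^ 2 = v := by
  obtain ⟨n, hn, x, y, z, hxyz⟩ := h.exists_modEq (NeZero.pos m) v.val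
  refine ⟨x, y, ?_⟩
  have h1 := congrArg (Int.cast : ℤ → ZMod m) hxyz
  push_cast at h1
  rw [(ZMod.natCast_eq_zero_iff c m).2 hmc, zero_mul, add_zero] at h1
  rw [h1, (ZMod.natCast_eq_natCast_iff _ _ _).2 hn, ZMod.natCast_zmod_val]

theorem isQR_of_asympUniversal (ha : 0 < a) (hb : 0 < b) (hc : 0 < c)
    (h : AsympUniversal fun n => ∃ (x y : ℤ) (z : ℕ),
      a * x ^ 2 + b * y ^ 2 + c * (triangular z : ℤ) = n) :
    isQR (-(2 * (b : ℤ) * c)) (oddPart a) ∧ isQR (-(2 * (a : ℤ) * c)) (oddPart b) ∧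
      isQR (-((a : ℤ) * b)) (oddPart c) := by
  refine ⟨fun p hp hpd => ?_, fun p hp hpd => ?_, fun p hp hpd => ?_⟩
  · obtain ⟨hd, hp2⟩ := (dvd_oddPart_iff hp ha).1 hpd
    refine legendreSym_eq_one_of_mul_sq hp (k := 2) ?_
    convert legendreSym_eq_one_of_forall_exists_dvd hp hp2 (A := 8 * a) (B := 8 * b) (C := c)
      ((Int.natCast_dvd_natCast.2 hd).mul_left 8)
      (exists_sq_dvd_of_asympUniversal h hp hp2) using 2
    ring
  · obtain ⟨hd, hp2⟩ := (dvd_oddPart_iff hp hb).1 hpd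
    refine legendreSym_eq_one_of_mul_sq hp (k := 2) ?_
    convert legendreSym_eq_one_of_forall_exists_dvd hp hp2 (A := 8 * b) (B := 8 * a) (C := c)
      ((Int.natCast_dvd_natCast.2 hd).mul_left 8) (fun v => ?_) using 2
    · ring
    · obtain ⟨x, y, w, hv⟩ := exists_sq_dvd_of_asympUniversal h hp hp2 v
      exact ⟨y, x, w, by rwa [add_comm (8 * b * y ^ 2 : ℤ)]⟩
  · obtain ⟨hd, hp2⟩ := (dvd_oddPart_iff hp hc).1 hpd
    refine legendreSym_eq_one_of_mul_sq hp (k := 8) ?_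
    convert legendreSym_eq_one_of_forall_exists_dvd hp hp2 (A := c) (B := 8 * a) (C := 8 * b)
      (Int.natCast_dvd_natCast.2 hd) (fun v => ?_) using 2
    · ring
    · obtain ⟨x, y, w, hv⟩ := exists_sq_dvd_of_asympUniversal h hp hp2 v
      exact ⟨w, x, y, by convert hv using 1; ring⟩

theorem dyadic_of_asympUniversal
    (h : AsympUniversal fun n => ∃ (x y : ℤ) (z : ℕ),
      a * x ^ 2 + b * y ^ 2 + c * (triangular z : ℤ) = n) :
    ¬ (4 ∣ c) ∨ ((4 ∣ c ∧ ¬ (8 ∣ c)) ∧ (2 ∣ a * b ∧ ¬ (4 ∣ a * b))) := by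
  rw [or_iff_not_imp_left, not_not]
  intro h4
  refine ⟨⟨h4, fun h8 => ?_⟩, ?_⟩
  · have key : ∀ a b : ZMod 8, ¬ ∀ v, ∃ x y, a * x ^ 2 + b * y ^ 2 = v := by decide +kernel
    exact key a b (exists_eq_zmod_of_asympUniversal h h8)
  · have key : ∀ a b : ZMod 4, (∀ v, ∃ x y, a * x ^ 2 + b * y ^ 2 = v) → a * b = 2 := by decide
    have h1 := key a b (exists_eq_zmod_of_asympUniversal h h4)
    have h2 : a * b ≡ 2 [MOD 4] := (ZMod.natCast_eq_natCast_iff _ _ _).1 (by exact_mod_cast h1)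
    simp only [Nat.ModEq] at h2
    omega

end Necessity

/-- Kane–Sun: `a·x² + b·y² + c·t_z` (with `x, y ∈ ℤ`, `z ∈ ℕ`) is
asymptotically universal iff `-2bc R a'`, `-2ac R b'`, `-ab R c'`, and either
`4 ∤ c`, or both `4 ∥ c` and `2 ∥ ab`. -/
theorem asympUniversal_two_squares_triangular_iff (a b c : ℕ)
    (ha : 0 < a) (hb : 0 < b) (hc : 0 < c)
    (hgcd : Nat.gcd a (Nat.gcd b c) = 1) :
    AsympUniversal (fun n => ∃ (x y : ℤ) (z : ℕ),
        a * x ^ 2 + b * y ^ 2 + c * (triangular z : ℤ) = n) ↔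
      ((isQR (-(2 * (b : ℤ) * c)) (oddPart a) ∧
          isQR (-(2 * (a : ℤ) * c)) (oddPart b) ∧
          isQR (-((a : ℤ) * b)) (oddPart c)) ∧
        (¬ (4 ∣ c) ∨ ((4 ∣ c ∧ ¬ (8 ∣ c)) ∧ (2 ∣ a * b ∧ ¬ (4 ∣ a * b))))) := by
  refine ⟨fun h => ⟨isQR_of_asympUniversal ha hb hc h, dyadic_of_asympUniversal h⟩, ?_⟩
  rintro ⟨⟨hqa, hqb, hqc⟩, h2⟩
  exact asympUniversal_of_locSol ha hb hc (locSol_of_isQR ha hb hc hgcd hqa hqb hqc h2)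
end

section
/- Every positive integer n ≡ 6 (mod 8) can be written as a sum of three or fewer squares; more precisely, writing n = 8m + 6, if m = 4t_x + t_y + t_z then n = (4x+2)² + (2y+1)² + (2z+1)²; if m = 4t_x + t_y then n = (4x+2)² + (2y+1)² + 1; and if m = t_x + t_y then n = (2x+1)² + (2y+1)² + 4. -/
/-- Every integer has a representative modulo `a > 0` of absolute value at most `a / 2`. -/
theorem Int.exists_abs_two_mul_add_mul_le (t : ℤ) {a : ℤ} (ha : 0 < a) :
    ∃ k : ℤ, |2 * (t + k * a)| ≤ a := by
  refine ⟨-((2 * t + a) / (2 * a)), ?_⟩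
  have h1 := Int.emod_nonneg (2 * t + a) (by omega : (2 * a) ≠ 0)
  have h2 := Int.emod_lt_of_pos (2 * t + a) (by omega : 0 < 2 * a)
  have h3 := Int.emod_add_mul_ediv (2 * t + a) (2 * a)
  rw [abs_le]
  constructor <;> linarith

/-- A positive definite integral ternary quadratic form of determinant one, with even
off-diagonal coefficients, takes only values that are sums of three squares. -/
theorem exists_sum_three_sq_of_det_eq_one (a b c r s t : ℤ) (ha : 0 < a)
    (hD : 0 < a * b - t ^ 2)
    (hdet : a * b * c + 2 * r * s * t - a * r ^ 2 - b * s ^ 2 - c * t ^ 2 = 1) (x y z : ℤ) :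
    ∃ u v w : ℤ, a * x ^ 2 + b * y ^ 2 + c * z ^ 2 + 2 * r * y * z + 2 * s * x * z
      + 2 * t * x * y = u ^ 2 + v ^ 2 + w ^ 2 := by
  obtain ⟨k, hk⟩ := Int.exists_abs_two_mul_add_mul_le t ha
  obtain ⟨b', hb'⟩ : ∃ b', b' = b + 2 * k * t + k ^ 2 * a := ⟨_, rfl⟩
  obtain ⟨r', hr'⟩ : ∃ r', r' = r + k * s := ⟨_, rfl⟩
  obtain ⟨t', ht'⟩ : ∃ t', t' = t + k * a := ⟨_, rfl⟩
  have hD' : a * b' - t' ^ 2 = a * b - t ^ 2 := by subst_vars; ring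
  have hdet' : a * b' * c + 2 * r' * s * t' - a * r' ^ 2 - b' * s ^ 2 - c * t' ^ 2 = 1 := by
    rw [← hdet]; subst_vars; ring
  rw [← ht'] at hk
  have hb'_pos : 0 < b' := by
    have : 0 < a * b' := by nlinarith [sq_nonneg t']
    exact pos_of_mul_pos_right this ha.le
  by_cases hba : b' < a
  · obtain ⟨u, v, w, h⟩ := exists_sum_three_sq_of_det_eq_one b' a c s r' t' hb'_pos
      (by linarith) (by linarith) y (x - k * y) z
    exact ⟨u, v, w, by rw [← h]; subst_vars; ring⟩
  obtain ⟨l, hl⟩ := Int.exists_abs_two_mul_add_mul_le (a * r' - s * t') (hD'.symm ▸ hD)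
  obtain ⟨c', hc'⟩ : ∃ c', c' = c + 2 * l * r' + l ^ 2 * b' := ⟨_, rfl⟩
  obtain ⟨r'', hr''⟩ : ∃ r'', r'' = r' + l * b' := ⟨_, rfl⟩
  obtain ⟨s', hs'⟩ : ∃ s', s' = s + l * t' := ⟨_, rfl⟩
  have hE : a * r' - s * t' + l * (a * b' - t' ^ 2) = a * r'' - s' * t' := by
    rw [hr'', hs']; ring
  rw [hE] at hl
  have hdet'' : a * b' * c' + 2 * r'' * s' * t' - a * r'' ^ 2 - b' * s' ^ 2 - c' * t' ^ 2 = 1 := by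
    rw [← hdet', hc', hr'', hs']; ring
  have hDF : (a * b' - t' ^ 2) * (a * c' - s' ^ 2) - (a * r'' - s' * t') ^ 2 = a := by
    linear_combination a * hdet''
  have hF : 0 < a * c' - s' ^ 2 := by
    have : 0 < (a * b' - t' ^ 2) * (a * c' - s' ^ 2) := by
      nlinarith [sq_nonneg (a * r'' - s' * t')]
    exact pos_of_mul_pos_right this (hD'.symm ▸ hD).le
  by_cases hFD : a * c' - s' ^ 2 < a * b - t ^ 2
  · obtain ⟨u, v, w, h⟩ := exists_sum_three_sq_of_det_eq_one a c' b' r'' t' s' ha hF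
      (by linarith) (x - k * y) z (y - l * z)
    exact ⟨u, v, w, by rw [← h]; subst_vars; ring⟩
  have hform : a * x ^ 2 + b * y ^ 2 + c * z ^ 2 + 2 * r * y * z + 2 * s * x * z
      + 2 * t * x * y = a * (x - k * y) ^ 2 + b' * (y - l * z) ^ 2 + c' * z ^ 2
      + 2 * r'' * (y - l * z) * z + 2 * s' * (x - k * y) * z
      + 2 * t' * (x - k * y) * (y - l * z) := by
    subst_vars; ring
  rw [hform]
  clear hform hdet' hdet hE hc' hr'' hs' hb' hr' ht'
  rw [← hD'] at hFD hD
  clear hD'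
  generalize hDdef : a * b' - t' ^ 2 = D at *
  generalize hFdef : a * c' - s' ^ 2 = F at *
  generalize hEdef : a * r'' - s' * t' = E at *
  push Not at hba hFD
  have ht2 : 4 * t' ^ 2 ≤ a ^ 2 := by
    have := sq_le_sq' (abs_le.mp hk).1 (abs_le.mp hk).2
    linarith
  have hE2 : 4 * E ^ 2 ≤ D ^ 2 := by
    have := sq_le_sq' (abs_le.mp hl).1 (abs_le.mp hl).2
    linarith
  have h1 : 3 * a ^ 2 ≤ 4 * D := by nlinarith
  have h2 : 3 * D ^ 2 ≤ 4 * a := by nlinarith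
  have ha1 : a = 1 := by
    by_contra hne
    have ha2 : 2 ≤ a := by omega
    have : 3 * a ≤ 2 * D := by nlinarith
    nlinarith
  subst ha1
  have hD1 : D = 1 := by nlinarith
  have ht0 : t' = 0 := by rw [abs_le] at hk; omega
  have hE0 : E = 0 := by rw [abs_le] at hl; omega
  subst hD1 ht0 hE0
  have hb1 : b' = 1 := by linarith
  have hr0 : r'' = 0 := by linarith
  have hc1 : c' = 1 + s' ^ 2 := by linarith
  exact ⟨x - k * y + s' * z, y - l * z, z, by rw [hb1, hr0, hc1]; ring⟩
termination_by (a.toNat, (a * b - t ^ 2).toNat)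
decreasing_by
  · apply Prod.Lex.left; omega
  · apply Prod.Lex.right; omega

/-- For `n ≡ 2 (mod 4)` some `d` makes `d * n - 1` a prime modulo which `-d` is a square. -/
theorem Nat.exists_prime_dvd_sq_add_of_mod_four_eq_two {n : ℕ} (hn : n % 4 = 2) :
    ∃ (p d : ℕ) (e : ℤ), p.Prime ∧ 0 < d ∧ p + 1 = d * n ∧ (p : ℤ) ∣ e ^ 2 + d := by
  have hcop : Nat.Coprime (n - 1) (4 * n) := by
    refine Nat.Coprime.mul_right ?_ ?_
    · have : Nat.Coprime (n - 1) (2 ^ 2) :=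
        Nat.Coprime.pow_right 2 (Nat.coprime_two_right.mpr (Nat.odd_iff.mpr (by omega)))
      simpa using this
    · obtain ⟨m, rfl⟩ : ∃ m, n = m + 1 := ⟨n - 1, by omega⟩
      simp
  obtain ⟨p, hpn, hp, hmod⟩ := Nat.forall_exists_prime_gt_and_modEq n (by omega) hcop
  obtain ⟨j, hj⟩ := (Nat.modEq_iff_dvd' (by omega)).mp hmod.symm
  have hpd : p + 1 = (4 * j + 1) * n := by
    have : p = 4 * n * j + (n - 1) := by omega
    have h1 : n - 1 + 1 = n := by omega
    rw [this, add_assoc, h1]; ring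
  have hp4 : p % 4 = 1 := by
    have : p = 4 * (n * j) + (n - 1) := by rw [← mul_assoc]; omega
    omega
  have := Fact.mk hp
  have hodd : Odd (4 * j + 1) := ⟨2 * j, by ring⟩
  have hJ : jacobiSym (-((4 * j + 1 : ℕ) : ℤ)) p = 1 := by
    rw [jacobiSym.neg _ (Nat.odd_iff.mpr (by omega)), ZMod.χ₄_nat_one_mod_four hp4, one_mul,
      jacobiSym.quadratic_reciprocity_one_mod_four (by omega) (Nat.odd_iff.mpr (by omega)),
      jacobiSym.mod_left' (a₂ := -1), jacobiSym.at_neg_one hodd,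
      ZMod.χ₄_nat_one_mod_four (by omega)]
    refine Int.ModEq.symm ((Int.modEq_iff_dvd).mpr ⟨n, ?_⟩)
    have : (p : ℤ) + 1 = ((4 * j + 1 : ℕ) : ℤ) * n := by exact_mod_cast hpd
    linarith
  obtain ⟨e, he⟩ := ZMod.isSquare_of_jacobiSym_eq_one hJ
  obtain ⟨e, rfl⟩ := ZMod.intCast_surjective e
  refine ⟨p, 4 * j + 1, e, hp, by omega, hpd, ?_⟩
  rw [← ZMod.intCast_zmod_eq_zero_iff_dvd]
  push_cast at he ⊢
  linear_combination -he

/-- Every `n ≡ 2 (mod 4)` is a sum of three squares. -/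
theorem Nat.exists_sum_three_sq_of_mod_four_eq_two {n : ℕ} (hn : n % 4 = 2) :
    ∃ x y z : ℕ, n = x ^ 2 + y ^ 2 + z ^ 2 := by
  obtain ⟨p, d, e, hp, hd, hpd, a, ha⟩ := Nat.exists_prime_dvd_sq_add_of_mod_four_eq_two hn
  have hp0 : (0 : ℤ) < p := by exact_mod_cast hp.pos
  have hd0 : (0 : ℤ) < d := by exact_mod_cast hd
  have hpd' : (p : ℤ) + 1 = d * n := by exact_mod_cast hpd
  have ha0 : 0 < a := pos_of_mul_pos_right (by rw [← ha]; positivity) hp0.le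
  obtain ⟨u, v, w, h⟩ := exists_sum_three_sq_of_det_eq_one a p n 0 1 e ha0 (by linarith)
    (by linear_combination (-(n : ℤ)) * ha - hpd') 0 0 1
  refine ⟨u.natAbs, v.natAbs, w.natAbs, ?_⟩
  zify
  simp only [sq_abs]
  linarith

theorem eight_mul_triangular (k : ℕ) : 8 * triangular k + 1 = (2 * k + 1) ^ 2 := by
  have h : 2 * triangular k = k * (k + 1) :=
    Nat.mul_div_cancel' (even_iff_two_dvd.mp (Nat.even_mul_succ_self k))
  linear_combination 4 * h

/-- Every positive integer `n ≡ 6 (mod 8)` is a sum of three or fewer squares,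
via explicit identities for `n = 8m + 6`. -/
theorem sum_three_squares_of_mod_eight_six :
    (∀ m x y z : ℕ, m = 4 * triangular x + triangular y + triangular z →
        8 * m + 6 = (4 * x + 2) ^ 2 + (2 * y + 1) ^ 2 + (2 * z + 1) ^ 2) ∧
      (∀ m x y : ℕ, m = 4 * triangular x + triangular y →
        8 * m + 6 = (4 * x + 2) ^ 2 + (2 * y + 1) ^ 2 + 1) ∧
      (∀ m x y : ℕ, m = triangular x + triangular y →
        8 * m + 6 = (2 * x + 1) ^ 2 + (2 * y + 1) ^ 2 + 4) ∧
      (∀ n : ℕ, 0 < n → n % 8 = 6 → ∃ x y z : ℕ, n = x ^ 2 + y ^ 2 + z ^ 2) := by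
  refine ⟨?_, ?_, ?_, fun n _ hn => Nat.exists_sum_three_sq_of_mod_four_eq_two (by omega)⟩
  · rintro m x y z rfl
    linear_combination 4 * eight_mul_triangular x + eight_mul_triangular y + eight_mul_triangular z
  · rintro m x y rfl
    linear_combination 4 * eight_mul_triangular x + eight_mul_triangular y
  · rintro m x y rfl
    linear_combination eight_mul_triangular x + eight_mul_triangular y
end
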